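/- arXiv:1404.1867 — 2 statements merged into one kernel-verified Lean document; each statement's English description precedes it below -/
import Mathlib

section
/- Let V be a real scalar product space and T a self-adjoint linear operator on V, and suppose V = V_1 ⊥ ⋯ ⊥ V_k and V = W_1 ⊥ ⋯ ⊥ W_m are two metric-Jordan decompositions for T. Then for every λ ∈ ℝ, every integer p ≥ 1 and every sign ε = ±1, the number of indices i such that V_i is a real block with data (λ, p, ε) equals the number of indices j such that W_j is a real block with data (λ, p, ε); and for every a ∈ ℝ, b > 0 and p ≥ 1, the number of indices i such that V_i is a complex block with data (a, b, p) equals the number of indices j such that W_j is a complex block with data (a, b, p). In particular k = m. -/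
section MetricJordan

variable {V : Type*} [AddCommGroup V] [Module ℝ V]

/-- A real metric-Jordan block for the bilinear form `B` and operator `T` with data
`(lam, p, ε)`: a subspace with a basis `v 1, …, v p` forming a skew-normal sequence of
sign `ε = ±1` such that `T (v j) = lam • v j + v (j+1)` (with `v (p+1) = 0`). -/
def IsRealBlock (B : V →ₗ[ℝ] V →ₗ[ℝ] ℝ) (T : Module.End ℝ V)
    (lam : ℝ) (p : ℕ) (ε : ℝ) (W : Submodule ℝ V) : Prop :=
  0 < p ∧ (ε = 1 ∨ ε = -1) ∧
  ∃ v : ℕ → V,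
    v (p + 1) = 0 ∧
    (∀ j, 1 ≤ j → j ≤ p → T (v j) = lam • v j + v (j + 1)) ∧
    (∀ i j, 1 ≤ i → i ≤ p → 1 ≤ j → j ≤ p →
      B (v i) (v j) = if i + j = p + 1 then ε else 0) ∧
    LinearIndependent ℝ (fun i : Fin p => v (i + 1)) ∧
    W = Submodule.span ℝ (v '' Set.Icc 1 p)

/-- A complex metric-Jordan block for the bilinear form `B` and operator `T` with data
`(a, b, p)`, `b > 0`: a subspace with a basis `u 1, v 1, …, u p, v p` with
`B (u i) (u j) = 1 = - B (v i) (v j)` when `i + j = p + 1`, all other scalar products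
zero, and `T (u j) = a • u j - b • v j + u (j+1)`,
`T (v j) = b • u j + a • v j + v (j+1)` (with `u (p+1) = v (p+1) = 0`). -/
def IsComplexBlock (B : V →ₗ[ℝ] V →ₗ[ℝ] ℝ) (T : Module.End ℝ V)
    (a b : ℝ) (p : ℕ) (W : Submodule ℝ V) : Prop :=
  0 < p ∧ 0 < b ∧
  ∃ u v : ℕ → V,
    u (p + 1) = 0 ∧ v (p + 1) = 0 ∧
    (∀ j, 1 ≤ j → j ≤ p → T (u j) = a • u j - b • v j + u (j + 1)) ∧
    (∀ j, 1 ≤ j → j ≤ p → T (v j) = b • u j + a • v j + v (j + 1)) ∧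
    (∀ i j, 1 ≤ i → i ≤ p → 1 ≤ j → j ≤ p →
      B (u i) (u j) = if i + j = p + 1 then 1 else 0) ∧
    (∀ i j, 1 ≤ i → i ≤ p → 1 ≤ j → j ≤ p →
      B (v i) (v j) = if i + j = p + 1 then -1 else 0) ∧
    (∀ i j, 1 ≤ i → i ≤ p → 1 ≤ j → j ≤ p → B (u i) (v j) = 0) ∧
    LinearIndependent ℝ
      (Sum.elim (fun i : Fin p => u (i + 1)) (fun i : Fin p => v (i + 1))) ∧
    W = Submodule.span ℝ (u '' Set.Icc 1 p ∪ v '' Set.Icc 1 p)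

/-- A metric-Jordan decomposition of `V` for the operator `T`: an orthogonal direct sum
of `T`-invariant subspaces each of which is a real block (for some data `(lam, p, ε)`)
or a complex block (for some data `(a, b, p)` with `b > 0`). -/
def IsMetricJordanDecomposition (B : V →ₗ[ℝ] V →ₗ[ℝ] ℝ) (T : Module.End ℝ V)
    {k : ℕ} (W : Fin k → Submodule ℝ V) : Prop :=
  (⨆ i, W i) = ⊤ ∧ iSupIndep W ∧
  (∀ i j, i ≠ j → ∀ x ∈ W i, ∀ y ∈ W j, B x y = 0) ∧
  (∀ i, ∀ x ∈ W i, T x ∈ W i) ∧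
  ∀ i, (∃ lam p ε, IsRealBlock B T lam p ε (W i)) ∨
       (∃ a b p, IsComplexBlock B T a b p (W i))

/-- `HasPosIndex B S p ε U n` says that, on `U ⊓ ker (S ^ p)`, the quadratic form
`x ↦ ε * B x (S ^ (p - 1) x)` has positive index of inertia `n`: that subspace is the sum of an
`n`-dimensional subspace where the form is positive definite and one where it is nonpositive. -/
def HasPosIndex (B : V →ₗ[ℝ] V →ₗ[ℝ] ℝ) (S : Module.End ℝ V) (p : ℕ) (ε : ℝ)
    (U : Submodule ℝ V) (n : ℕ) : Prop :=
  ∃ P N : Submodule ℝ V, P ⊔ N = U ⊓ LinearMap.ker (S ^ p) ∧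
    (∀ x ∈ P, x ≠ 0 → 0 < ε * B x ((S ^ (p - 1)) x)) ∧
    (∀ x ∈ N, ε * B x ((S ^ (p - 1)) x) ≤ 0) ∧
    Module.finrank ℝ P = n

variable {B : V →ₗ[ℝ] V →ₗ[ℝ] ℝ} {S T : Module.End ℝ V} {p : ℕ} {ε : ℝ}
  {U U₁ U₂ : Submodule ℝ V}

theorem disjoint_of_pos_of_nonpos {q : V → ℝ} {P N : Submodule ℝ V}
    (hP : ∀ x ∈ P, x ≠ 0 → 0 < q x) (hN : ∀ x ∈ N, q x ≤ 0) : Disjoint P N := by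
  rw [Submodule.disjoint_def]
  intro x hxP hxN
  by_contra hx
  exact absurd (hP x hxP hx) (hN x hxN).not_gt

theorem finrank_add_finrank_of_disjoint [FiniteDimensional ℝ V] {P N : Submodule ℝ V}
    (h : Disjoint P N) :
    Module.finrank ℝ P + Module.finrank ℝ N = Module.finrank ℝ (P ⊔ N : Submodule ℝ V) := by
  have := Submodule.finrank_sup_add_finrank_inf_eq P N
  rw [h.eq_bot, finrank_bot] at this
  omega

/-- Sylvester's law of inertia, as a comparison of positive indices. -/
theorem HasPosIndex.le [FiniteDimensional ℝ V] {n m : ℕ}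
    (h₁ : HasPosIndex B S p ε U n) (h₂ : HasPosIndex B S p ε U m) : n ≤ m := by
  obtain ⟨P, N, hPN, hP, hN, rfl⟩ := h₁
  obtain ⟨P', N', hPN', hP', hN', rfl⟩ := h₂
  have h₁ := finrank_add_finrank_of_disjoint (disjoint_of_pos_of_nonpos hP hN')
  have h₂ := finrank_add_finrank_of_disjoint (disjoint_of_pos_of_nonpos hP' hN')
  have h₃ : P ⊔ N' ≤ P' ⊔ N' :=
    sup_le (le_sup_left.trans (hPN.trans hPN'.symm).le) le_sup_right
  have h₄ := Submodule.finrank_mono h₃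
  omega

theorem HasPosIndex.unique [FiniteDimensional ℝ V] {n m : ℕ}
    (h₁ : HasPosIndex B S p ε U n) (h₂ : HasPosIndex B S p ε U m) : n = m :=
  le_antisymm (h₁.le h₂) (h₂.le h₁)

theorem hasPosIndex_zero_of_nonpos
    (h : ∀ x ∈ U, (S ^ p) x = 0 → ε * B x ((S ^ (p - 1)) x) ≤ 0) :
    HasPosIndex B S p ε U 0 :=
  ⟨⊥, U ⊓ LinearMap.ker (S ^ p), by simp, fun x hx h0 => absurd hx h0,
    fun x hx => h x hx.1 hx.2, finrank_bot ℝ V⟩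

theorem pow_apply_mem (hU : ∀ x ∈ U, S x ∈ U) (n : ℕ) {x : V} (hx : x ∈ U) :
    (S ^ n) x ∈ U := by
  induction n with
  | zero => simpa using hx
  | succ n ih => rw [pow_succ', Module.End.mul_apply]; exact hU _ ih

theorem HasPosIndex.sup [FiniteDimensional ℝ V] {n₁ n₂ : ℕ}
    (hU₁ : ∀ x ∈ U₁, S x ∈ U₁) (hU₂ : ∀ x ∈ U₂, S x ∈ U₂) (hdisj : Disjoint U₁ U₂)
    (h₁₂ : ∀ x ∈ U₁, ∀ y ∈ U₂, B x y = 0) (h₂₁ : ∀ x ∈ U₂, ∀ y ∈ U₁, B x y = 0)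
    (h₁ : HasPosIndex B S p ε U₁ n₁) (h₂ : HasPosIndex B S p ε U₂ n₂) :
    HasPosIndex B S p ε (U₁ ⊔ U₂) (n₁ + n₂) := by
  obtain ⟨P₁, N₁, hPN₁, hP₁, hN₁, rfl⟩ := h₁
  obtain ⟨P₂, N₂, hPN₂, hP₂, hN₂, rfl⟩ := h₂
  have hPU₁ : P₁ ≤ U₁ := le_sup_left.trans (hPN₁.le.trans inf_le_left)
  have hPU₂ : P₂ ≤ U₂ := le_sup_left.trans (hPN₂.le.trans inf_le_left)
  have hNU₁ : N₁ ≤ U₁ := le_sup_right.trans (hPN₁.le.trans inf_le_left)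
  have hNU₂ : N₂ ≤ U₂ := le_sup_right.trans (hPN₂.le.trans inf_le_left)
  have hq : ∀ x ∈ U₁, ∀ y ∈ U₂, ε * B (x + y) ((S ^ (p - 1)) (x + y)) =
      ε * B x ((S ^ (p - 1)) x) + ε * B y ((S ^ (p - 1)) y) := by
    intro x hx y hy
    have e₁ := h₁₂ x hx _ (pow_apply_mem hU₂ (p - 1) hy)
    have e₂ := h₂₁ y hy _ (pow_apply_mem hU₁ (p - 1) hx)
    simp only [map_add, LinearMap.add_apply, e₁, e₂]
    ring
  refine ⟨P₁ ⊔ P₂, N₁ ⊔ N₂, ?_, ?_, ?_,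
    (finrank_add_finrank_of_disjoint (hdisj.mono hPU₁ hPU₂)).symm⟩
  · rw [sup_sup_sup_comm, hPN₁, hPN₂]
    apply le_antisymm
    · exact sup_le (inf_le_inf_right _ le_sup_left) (inf_le_inf_right _ le_sup_right)
    · rintro z ⟨hz, hSz⟩
      obtain ⟨x, hx, y, hy, rfl⟩ := Submodule.mem_sup.1 hz
      have hsum : (S ^ p) x + (S ^ p) y = 0 := by
        rw [← map_add]; exact hSz
      have hSx := pow_apply_mem hU₁ p hx
      have hSy := pow_apply_mem hU₂ p hy
      have hx0 : (S ^ p) x = 0 := by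
        refine Submodule.disjoint_def.1 hdisj _ hSx ?_
        rw [eq_neg_of_add_eq_zero_left hsum]
        exact neg_mem hSy
      have hy0 : (S ^ p) y = 0 := by simpa [hx0] using hsum
      exact Submodule.add_mem_sup ⟨hx, hx0⟩ ⟨hy, hy0⟩
  · intro z hz hz0
    obtain ⟨x, hx, y, hy, rfl⟩ := Submodule.mem_sup.1 hz
    rw [hq x (hPU₁ hx) y (hPU₂ hy)]
    by_cases hx0 : x = 0
    · by_cases hy0 : y = 0
      · exact absurd (by simp [hx0, hy0]) hz0
      · simpa [hx0] using hP₂ y hy hy0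
    · by_cases hy0 : y = 0
      · simpa [hy0] using hP₁ x hx hx0
      · exact add_pos (hP₁ x hx hx0) (hP₂ y hy hy0)
  · intro z hz
    obtain ⟨x, hx, y, hy, rfl⟩ := Submodule.mem_sup.1 hz
    rw [hq x (hNU₁ hx) y (hNU₂ hy)]
    exact add_nonpos (hN₁ x hx) (hN₂ y hy)

theorem hasPosIndex_biSup [FiniteDimensional ℝ V] {ι : Type*} {W : ι → Submodule ℝ V}
    (hind : iSupIndep W) (horth : ∀ i j, i ≠ j → ∀ x ∈ W i, ∀ y ∈ W j, B x y = 0)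
    (hinv : ∀ i, ∀ x ∈ W i, S x ∈ W i) {n : ι → ℕ}
    (hn : ∀ i, HasPosIndex B S p ε (W i) (n i)) (s : Finset ι) :
    HasPosIndex B S p ε (⨆ i ∈ s, W i) (∑ i ∈ s, n i) := by
  classical
  induction s using Finset.induction_on with
  | empty =>
    simp only [Finset.notMem_empty, iSup_false, iSup_bot, Finset.sum_empty]
    refine hasPosIndex_zero_of_nonpos fun x hx _ => ?_
    simp [(Submodule.mem_bot ℝ).1 hx]
  | insert a s ha ih =>
    rw [Finset.iSup_insert, Finset.sum_insert ha]
    refine HasPosIndex.sup (hinv a) ?_ ?_ ?_ ?_ (hn a) ih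
    · change (⨆ i ∈ s, W i) ≤ (⨆ i ∈ s, W i).comap S
      refine iSup₂_le fun i hi x hx => ?_
      exact (le_iSup₂_of_le i hi le_rfl : W i ≤ _) (hinv i x hx)
    · exact hind.disjoint_biSup (y := (s : Set ι)) (by simpa using ha)
    · intro x hx y hy
      have : (⨆ i ∈ s, W i) ≤ LinearMap.ker (B x) :=
        iSup₂_le fun i hi z hz => horth a i (fun h => ha (h ▸ hi)) x hx z hz
      exact this hy
    · intro x hx y hy
      have : (⨆ i ∈ s, W i) ≤ LinearMap.ker (B.flip y) :=
        iSup₂_le fun i hi z hz => horth i a (fun h => ha (h ▸ hi)) z hz y hy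
      exact this hx

theorem hasPosIndex_zero_of_isCoprime {f g : Polynomial ℝ} (hfg : IsCoprime f g) {r : ℕ}
    (hU : ∀ x ∈ U, ((Polynomial.aeval T g) ^ r) x = 0) :
    HasPosIndex B (Polynomial.aeval T f) p ε U 0 := by
  refine hasPosIndex_zero_of_nonpos fun x hx hfx => ?_
  have hd := Polynomial.disjoint_ker_aeval_of_isCoprime T (hfg.pow (m := p) (n := r))
  have h0 : x = 0 := by
    refine Submodule.disjoint_def.1 hd x ?_ ?_
    · simpa [LinearMap.mem_ker] using hfx
    · simpa [LinearMap.mem_ker] using hU x hx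
  simp [h0]

/-- A filtration `U = L 0, L 1, …, L r = 0` that `S` shifts by one step, inducing injective maps
between successive quotients, and with `L i ⟂ L j` for `i + j ≥ r`. -/
structure IsShiftFiltration (B : V →ₗ[ℝ] V →ₗ[ℝ] ℝ) (S : Module.End ℝ V) (U : Submodule ℝ V)
    (r : ℕ) (L : ℕ → Submodule ℝ V) : Prop where
  zero : L 0 = U
  eq_bot : L r = ⊥
  shift : ∀ j, ∀ x ∈ L j, S x ∈ L (j + 1)
  mem_succ : ∀ j, j + 1 < r → ∀ x ∈ L j, S x ∈ L (j + 2) → x ∈ L (j + 1)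
  orth : ∀ i j, r ≤ i + j → ∀ x ∈ L i, ∀ y ∈ L j, B x y = 0

namespace IsShiftFiltration

variable {L : ℕ → Submodule ℝ V} {r : ℕ}

theorem pow_shift (h : IsShiftFiltration B S U r L) (n j : ℕ) {x : V} (hx : x ∈ L j) :
    (S ^ n) x ∈ L (j + n) := by
  induction n with
  | zero => simpa using hx
  | succ n ih => rw [pow_succ', Module.End.mul_apply]; exact h.shift _ _ ih

theorem pow_eq_zero (h : IsShiftFiltration B S U r L) {x : V} (hx : x ∈ U) :
    (S ^ r) x = 0 := by
  have := h.pow_shift r 0 (h.zero ▸ hx)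
  rwa [zero_add, h.eq_bot, Submodule.mem_bot] at this

theorem mem_succ_of_pow (h : IsShiftFiltration B S U r L) (n j : ℕ) (hr : j + n < r) {x : V}
    (hx : x ∈ L j) (hS : (S ^ n) x ∈ L (j + n + 1)) : x ∈ L (j + 1) := by
  induction n with
  | zero => simpa using hS
  | succ n ih =>
    rw [pow_succ', Module.End.mul_apply] at hS
    exact ih (by omega) (h.mem_succ (j + n) (by omega) _ (h.pow_shift n j hx) hS)

theorem mem_of_pow_eq_zero (h : IsShiftFiltration B S U r L) {n : ℕ} {x : V}
    (hx : x ∈ U) (hS : (S ^ n) x = 0) (j : ℕ) (hj : j + n ≤ r) : x ∈ L j := by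
  induction j with
  | zero => exact h.zero ▸ hx
  | succ j ih =>
    exact h.mem_succ_of_pow n j (by omega) (ih (by omega)) (hS ▸ Submodule.zero_mem _)

theorem hasPosIndex_zero (h : IsShiftFiltration B S U r L) (hp : 0 < p) (hpr : r ≠ p) :
    HasPosIndex B S p ε U 0 := by
  refine hasPosIndex_zero_of_nonpos fun x hx hSx => ?_
  suffices B x ((S ^ (p - 1)) x) = 0 by simp [this]
  rcases lt_or_gt_of_ne hpr with hlt | hlt
  · rw [show p - 1 = (p - 1 - r) + r by omega, pow_add, Module.End.mul_apply, h.pow_eq_zero hx]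
    simp
  · have hxL := h.mem_of_pow_eq_zero hx hSx (r - p) (by omega)
    exact h.orth _ _ (by omega) x hxL _ (h.pow_shift (p - 1) (r - p) hxL)

theorem form_add (h : IsShiftFiltration B S U p L) (hp : 0 < p) {x y : V}
    (hx : x ∈ U) (hy : y ∈ L 1) :
    B (x + y) ((S ^ (p - 1)) (x + y)) = B x ((S ^ (p - 1)) x) := by
  have hSy : (S ^ (p - 1)) y = 0 := by
    have := h.pow_shift (p - 1) 1 hy
    rwa [show 1 + (p - 1) = p by omega, h.eq_bot, Submodule.mem_bot] at this
  have hyx : B y ((S ^ (p - 1)) x) = 0 :=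
    h.orth 1 (0 + (p - 1)) (by omega) y hy _ (h.pow_shift (p - 1) 0 (h.zero ▸ hx))
  simp [hSy, hyx]

theorem form_smul_add (h : IsShiftFiltration B S U p L) (hp : 0 < p) (c : ℝ) {x y : V}
    (hx : x ∈ U) (hy : y ∈ L 1) :
    B (c • x + y) ((S ^ (p - 1)) (c • x + y)) = c ^ 2 * B x ((S ^ (p - 1)) x) := by
  rw [h.form_add hp (Submodule.smul_mem _ c hx) hy]
  simp only [map_smul, LinearMap.smul_apply, smul_eq_mul]
  ring

theorem hasPosIndex_one (h : IsShiftFiltration B S U p L) (hp : 0 < p) {z w : V}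
    (hz : z ∈ U) (hw : w ∈ U) (hL : L 1 ≤ U)
    (hU : ∀ x ∈ U, ∃ c d : ℝ, ∃ y ∈ L 1, x = c • z + (d • w + y))
    (hzpos : 0 < ε * B z ((S ^ (p - 1)) z)) (hwneg : ε * B w ((S ^ (p - 1)) w) ≤ 0) :
    HasPosIndex B S p ε U 1 := by
  have hker : U ⊓ LinearMap.ker (S ^ p) = U :=
    inf_eq_left.2 fun x hx => h.pow_eq_zero hx
  refine ⟨ℝ ∙ z, (ℝ ∙ w) ⊔ L 1, ?_, ?_, ?_, ?_⟩
  · rw [hker]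
    apply le_antisymm
    · refine sup_le ?_ (sup_le ?_ hL)
      · simpa [Submodule.span_singleton_le_iff_mem] using hz
      · simpa [Submodule.span_singleton_le_iff_mem] using hw
    · intro x hx
      obtain ⟨c, d, y, hy, rfl⟩ := hU x hx
      exact Submodule.add_mem_sup (Submodule.mem_span_singleton.2 ⟨c, rfl⟩)
        (Submodule.add_mem_sup (Submodule.mem_span_singleton.2 ⟨d, rfl⟩) hy)
  · intro x hx hx0
    obtain ⟨c, rfl⟩ := Submodule.mem_span_singleton.1 hx
    have hc : c ≠ 0 := fun hc => hx0 (by simp [hc])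
    have := h.form_smul_add hp c hz (Submodule.zero_mem _)
    rw [add_zero] at this
    rw [this, mul_left_comm]
    positivity
  · intro x hx
    obtain ⟨x', hx', y, hy, rfl⟩ := Submodule.mem_sup.1 hx
    obtain ⟨d, rfl⟩ := Submodule.mem_span_singleton.1 hx'
    rw [h.form_smul_add hp d hw hy, mul_left_comm]
    exact mul_nonpos_of_nonneg_of_nonpos (sq_nonneg d) hwneg
  · refine finrank_span_singleton ?_
    rintro rfl
    simp at hzpos

end IsShiftFiltration

/-- The span of the vectors `v (j + 1), …, v r`. -/
def tailSpan (v : ℕ → V) (r j : ℕ) : Submodule ℝ V :=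
  Submodule.span ℝ (v '' Set.Icc (j + 1) r)

section TailSpan

variable {u v : ℕ → V} {r : ℕ}

theorem mem_tailSpan {i j : ℕ} (hij : j < i) (hir : i ≤ r) : v i ∈ tailSpan v r j :=
  Submodule.subset_span ⟨i, ⟨hij, hir⟩, rfl⟩

theorem succ_mem_tailSpan (hv : v (r + 1) = 0) {i j : ℕ} (hij : j < i) (hir : i ≤ r) :
    v (i + 1) ∈ tailSpan v r (j + 1) := by
  rcases hir.lt_or_eq with h | rfl
  · exact mem_tailSpan (by omega) h
  · rw [hv]; exact Submodule.zero_mem _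

theorem tailSpan_le {M : Submodule ℝ V} {j : ℕ} (h : ∀ i, j < i → i ≤ r → v i ∈ M) :
    tailSpan v r j ≤ M := by
  refine Submodule.span_le.2 ?_
  rintro _ ⟨i, hi, rfl⟩
  exact h i hi.1 hi.2

theorem tailSpan_eq_bot {j : ℕ} (h : r ≤ j) : tailSpan v r j = ⊥ :=
  le_bot_iff.1 (tailSpan_le fun i _ _ => by omega)

theorem tailSpan_anti {i j : ℕ} (h : i ≤ j) : tailSpan v r j ≤ tailSpan v r i :=
  tailSpan_le fun _ hk hkr => mem_tailSpan (by omega) hkr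

theorem exists_of_mem_tailSpan {j : ℕ} (hj : j < r) {x : V} (hx : x ∈ tailSpan v r j) :
    ∃ c : ℝ, ∃ y ∈ tailSpan v r (j + 1), x = c • v (j + 1) + y := by
  have h : Set.Icc (j + 1) r = insert (j + 1) (Set.Icc (j + 1 + 1) r) := by
    ext i; simp only [Set.mem_Icc, Set.mem_insert_iff]; omega
  rw [tailSpan, h, Set.image_insert_eq, Submodule.mem_span_insert] at hx
  exact hx

theorem orth_tailSpan {i j : ℕ}
    (h : ∀ k l, i < k → k ≤ r → j < l → l ≤ r → B (u k) (v l) = 0) :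
    ∀ x ∈ tailSpan u r i, ∀ y ∈ tailSpan v r j, B x y = 0 := by
  intro x hx y hy
  have hx' : tailSpan u r i ≤ LinearMap.ker (B.flip y) := by
    refine tailSpan_le fun k hk hkr => ?_
    have hy' : tailSpan v r j ≤ LinearMap.ker (B (u k)) :=
      tailSpan_le fun l hl hlr => h k l hk hkr hl hlr
    exact hy' hy
  exact hx' hx

theorem isShiftFiltration_real (hε : ε ≠ 0) (hv : v (r + 1) = 0)
    (hS : ∀ j, 1 ≤ j → j ≤ r → S (v j) = v (j + 1))
    (hB : ∀ i j, 1 ≤ i → i ≤ r → 1 ≤ j → j ≤ r →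
      B (v i) (v j) = if i + j = r + 1 then ε else 0) :
    IsShiftFiltration B S (tailSpan v r 0) r (tailSpan v r) := by
  have hshift : ∀ j, ∀ x ∈ tailSpan v r j, S x ∈ tailSpan v r (j + 1) := by
    intro j
    change tailSpan v r j ≤ (tailSpan v r (j + 1)).comap S
    refine tailSpan_le fun i hi hir => ?_
    rw [Submodule.mem_comap, hS i (by omega) hir]
    exact succ_mem_tailSpan hv hi hir
  have horth : ∀ i j, r ≤ i + j → ∀ x ∈ tailSpan v r i, ∀ y ∈ tailSpan v r j, B x y = 0 := by
    intro i j hij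
    refine orth_tailSpan fun k l hk hkr hl hlr => ?_
    rw [hB k l (by omega) hkr (by omega) hlr, if_neg (by omega)]
  refine ⟨rfl, tailSpan_eq_bot le_rfl, hshift, ?_, horth⟩
  intro j hj x hx hSx
  obtain ⟨c, y, hy, rfl⟩ := exists_of_mem_tailSpan (by omega) hx
  rw [map_add, map_smul, hS _ (by omega) (by omega),
    Submodule.add_mem_iff_left _ (hshift _ y hy)] at hSx
  have h0 := horth (j + 2) (r - 2 - j) (by omega) _ hSx (v (r - 1 - j))
    (mem_tailSpan (by omega) (by omega))
  rw [map_smul, LinearMap.smul_apply, hB _ _ (by omega) (by omega) (by omega) (by omega),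
    if_pos (by omega), smul_eq_mul] at h0
  rw [(mul_eq_zero.1 h0).resolve_right hε]
  simpa using hy

theorem isShiftFiltration_complex {b : ℝ} (hb : b ≠ 0) (hu : u (r + 1) = 0) (hv : v (r + 1) = 0)
    (hSu : ∀ j, 1 ≤ j → j ≤ r →
      S (u j) + (2 * b) • v (j + 1) ∈ tailSpan u r (j + 1) ⊔ tailSpan v r (j + 1))
    (hSv : ∀ j, 1 ≤ j → j ≤ r →
      S (v j) - (2 * b) • u (j + 1) ∈ tailSpan u r (j + 1) ⊔ tailSpan v r (j + 1))
    (huu : ∀ i j, 1 ≤ i → i ≤ r → 1 ≤ j → j ≤ r →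
      B (u i) (u j) = if i + j = r + 1 then 1 else 0)
    (hvv : ∀ i j, 1 ≤ i → i ≤ r → 1 ≤ j → j ≤ r →
      B (v i) (v j) = if i + j = r + 1 then -1 else 0)
    (huv : ∀ i j, 1 ≤ i → i ≤ r → 1 ≤ j → j ≤ r → B (u i) (v j) = 0)
    (hvu : ∀ i j, 1 ≤ i → i ≤ r → 1 ≤ j → j ≤ r → B (v i) (u j) = 0) :
    IsShiftFiltration B S (tailSpan u r 0 ⊔ tailSpan v r 0) r
      (fun j => tailSpan u r j ⊔ tailSpan v r j) := by
  have hanti : ∀ {i j : ℕ}, i ≤ j →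
      tailSpan u r j ⊔ tailSpan v r j ≤ tailSpan u r i ⊔ tailSpan v r i :=
    fun h => sup_le_sup (tailSpan_anti h) (tailSpan_anti h)
  have hshift : ∀ j, ∀ x ∈ tailSpan u r j ⊔ tailSpan v r j,
      S x ∈ tailSpan u r (j + 1) ⊔ tailSpan v r (j + 1) := by
    intro j
    change tailSpan u r j ⊔ tailSpan v r j ≤
      (tailSpan u r (j + 1) ⊔ tailSpan v r (j + 1)).comap S
    refine sup_le (tailSpan_le fun i hi hir => ?_) (tailSpan_le fun i hi hir => ?_) <;>
      rw [Submodule.mem_comap]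
    · refine (Submodule.add_mem_iff_left _ ?_).1
        (hanti (show j + 1 ≤ i + 1 by omega) (hSu i (by omega) hir))
      exact Submodule.mem_sup_right (Submodule.smul_mem _ _ (succ_mem_tailSpan hv hi hir))
    · refine (Submodule.sub_mem_iff_left _ ?_).1
        (hanti (show j + 1 ≤ i + 1 by omega) (hSv i (by omega) hir))
      exact Submodule.mem_sup_left (Submodule.smul_mem _ _ (succ_mem_tailSpan hu hi hir))
  have horth : ∀ i j, r ≤ i + j → ∀ x ∈ tailSpan u r i ⊔ tailSpan v r i,
      ∀ y ∈ tailSpan u r j ⊔ tailSpan v r j, B x y = 0 := by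
    intro i j hij x hx y hy
    obtain ⟨x₁, hx₁, x₂, hx₂, rfl⟩ := Submodule.mem_sup.1 hx
    obtain ⟨y₁, hy₁, y₂, hy₂, rfl⟩ := Submodule.mem_sup.1 hy
    have e₁ : B x₁ y₁ = 0 := by
      refine orth_tailSpan (fun k l hk hkr hl hlr => ?_) x₁ hx₁ y₁ hy₁
      rw [huu k l (by omega) hkr (by omega) hlr, if_neg (by omega)]
    have e₂ : B x₂ y₂ = 0 := by
      refine orth_tailSpan (fun k l hk hkr hl hlr => ?_) x₂ hx₂ y₂ hy₂
      rw [hvv k l (by omega) hkr (by omega) hlr, if_neg (by omega)]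
    have e₃ : B x₁ y₂ = 0 := orth_tailSpan
      (fun k l hk hkr hl hlr => huv k l (by omega) hkr (by omega) hlr) x₁ hx₁ y₂ hy₂
    have e₄ : B x₂ y₁ = 0 := orth_tailSpan
      (fun k l hk hkr hl hlr => hvu k l (by omega) hkr (by omega) hlr) x₂ hx₂ y₁ hy₁
    simp [e₁, e₂, e₃, e₄]
  refine ⟨rfl, by simp [tailSpan_eq_bot le_rfl], hshift, ?_, horth⟩
  intro j hj x hx hSx
  obtain ⟨x₁, hx₁, x₂, hx₂, rfl⟩ := Submodule.mem_sup.1 hx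
  obtain ⟨α, y₁, hy₁, rfl⟩ := exists_of_mem_tailSpan (by omega) hx₁
  obtain ⟨β, y₂, hy₂, rfl⟩ := exists_of_mem_tailSpan (by omega) hx₂
  have hSy := hshift _ _ (Submodule.add_mem_sup hy₁ hy₂)
  have hmem : (2 * b * β) • u (j + 2) - (2 * b * α) • v (j + 2) ∈
      tailSpan u r (j + 2) ⊔ tailSpan v r (j + 2) := by
    have h₁ := Submodule.smul_mem _ α (hSu (j + 1) (by omega) (by omega))
    have h₂ := Submodule.smul_mem _ β (hSv (j + 1) (by omega) (by omega))
    have h₃ := sub_mem (sub_mem (sub_mem hSx hSy) h₁) h₂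
    convert h₃ using 1
    simp only [map_add, map_smul]
    module
  have hβ := horth (j + 2) (r - 2 - j) (by omega) _ hmem (u (r - 1 - j))
    (Submodule.mem_sup_left (mem_tailSpan (by omega) (by omega)))
  have hα := horth (j + 2) (r - 2 - j) (by omega) _ hmem (v (r - 1 - j))
    (Submodule.mem_sup_right (mem_tailSpan (by omega) (by omega)))
  rw [map_sub, map_smul, map_smul, LinearMap.sub_apply, LinearMap.smul_apply,
    LinearMap.smul_apply, huu _ _ (by omega) (by omega) (by omega) (by omega),
    hvu _ _ (by omega) (by omega) (by omega) (by omega), if_pos (by omega)] at hβ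
  rw [map_sub, map_smul, map_smul, LinearMap.sub_apply, LinearMap.smul_apply,
    LinearMap.smul_apply, hvv _ _ (by omega) (by omega) (by omega) (by omega),
    huv _ _ (by omega) (by omega) (by omega) (by omega), if_pos (by omega)] at hα
  have hβ0 : β = 0 := by simpa [hb] using hβ
  have hα0 : α = 0 := by simpa [hb] using hα
  simpa [hα0, hβ0] using Submodule.add_mem_sup hy₁ hy₂

theorem exists_pow_apply_of_complex {b : ℝ} (hb : b ≠ 0)
    (hshift : ∀ j, ∀ x ∈ tailSpan u r j ⊔ tailSpan v r j,
      S x ∈ tailSpan u r (j + 1) ⊔ tailSpan v r (j + 1))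
    (hSu : ∀ j, 1 ≤ j → j ≤ r →
      S (u j) + (2 * b) • v (j + 1) ∈ tailSpan u r (j + 1) ⊔ tailSpan v r (j + 1))
    (hSv : ∀ j, 1 ≤ j → j ≤ r →
      S (v j) - (2 * b) • u (j + 1) ∈ tailSpan u r (j + 1) ⊔ tailSpan v r (j + 1))
    (n : ℕ) (hn : n < r) :
    ∃ c d : ℝ, 0 < c ^ 2 + d ^ 2 ∧
      (S ^ n) (u 1) - (c • u (n + 1) + d • v (n + 1)) ∈
        tailSpan u r (n + 1) ⊔ tailSpan v r (n + 1) ∧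
      (S ^ n) (v 1) - (-d • u (n + 1) + c • v (n + 1)) ∈
        tailSpan u r (n + 1) ⊔ tailSpan v r (n + 1) := by
  induction n with
  | zero => exact ⟨1, 0, by norm_num, by simp, by simp⟩
  | succ n ih =>
    obtain ⟨c, d, hcd, h₁, h₂⟩ := ih (by omega)
    have hU := hSu (n + 1) (by omega) (by omega)
    have hV := hSv (n + 1) (by omega) (by omega)
    refine ⟨2 * b * d, -(2 * b * c), ?_, ?_, ?_⟩
    · have : (2 * b * d) ^ 2 + (-(2 * b * c)) ^ 2 = (2 * b) ^ 2 * (c ^ 2 + d ^ 2) := by ring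
      rw [this]
      positivity
    · convert add_mem (hshift _ _ h₁)
        (add_mem (Submodule.smul_mem _ c hU) (Submodule.smul_mem _ d hV)) using 1
      rw [pow_succ', Module.End.mul_apply]
      simp only [map_add, map_sub, map_smul]
      module
    · convert add_mem (hshift _ _ h₂)
        (add_mem (Submodule.smul_mem _ (-d) hU) (Submodule.smul_mem _ c hV)) using 1
      rw [pow_succ', Module.End.mul_apply]
      simp only [map_add, map_sub, map_smul]
      module

theorem exists_sq_sub_sq_eq (c d : ℝ) : ∃ α β : ℝ, α ^ 2 - β ^ 2 = c ∧ 2 * α * β = d := by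
  obtain ⟨z, hz⟩ := IsAlgClosed.exists_pow_nat_eq (Complex.mk c d) two_pos
  refine ⟨z.re, z.im, ?_, ?_⟩
  · have := congrArg Complex.re hz
    simp only [pow_two, Complex.mul_re] at this
    linarith
  · have := congrArg Complex.im hz
    simp only [pow_two, Complex.mul_im] at this
    linarith

theorem hasPosIndex_one_complex {b : ℝ} (hb : b ≠ 0) (hr : 0 < r) (hu : u (r + 1) = 0)
    (hv : v (r + 1) = 0)
    (hSu : ∀ j, 1 ≤ j → j ≤ r →
      S (u j) + (2 * b) • v (j + 1) ∈ tailSpan u r (j + 1) ⊔ tailSpan v r (j + 1))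
    (hSv : ∀ j, 1 ≤ j → j ≤ r →
      S (v j) - (2 * b) • u (j + 1) ∈ tailSpan u r (j + 1) ⊔ tailSpan v r (j + 1))
    (huu : ∀ i j, 1 ≤ i → i ≤ r → 1 ≤ j → j ≤ r →
      B (u i) (u j) = if i + j = r + 1 then 1 else 0)
    (hvv : ∀ i j, 1 ≤ i → i ≤ r → 1 ≤ j → j ≤ r →
      B (v i) (v j) = if i + j = r + 1 then -1 else 0)
    (huv : ∀ i j, 1 ≤ i → i ≤ r → 1 ≤ j → j ≤ r → B (u i) (v j) = 0)
    (hvu : ∀ i j, 1 ≤ i → i ≤ r → 1 ≤ j → j ≤ r → B (v i) (u j) = 0) :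
    HasPosIndex B S r 1 (tailSpan u r 0 ⊔ tailSpan v r 0) 1 := by
  have hL := isShiftFiltration_complex hb hu hv hSu hSv huu hvv huv hvu
  obtain ⟨c, d, hcd, h₁, h₂⟩ :=
    exists_pow_apply_of_complex hb hL.shift hSu hSv (r - 1) (by omega)
  rw [show r - 1 + 1 = r by omega, hL.eq_bot, Submodule.mem_bot, sub_eq_zero] at h₁ h₂
  obtain ⟨α, β, hα, hβ⟩ := exists_sq_sub_sq_eq c (-d)
  have hq : ∀ s t : ℝ, B (s • u 1 + t • v 1) ((S ^ (r - 1)) (s • u 1 + t • v 1)) =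
      c * (s ^ 2 - t ^ 2) - d * (2 * s * t) := by
    intro s t
    have e₁ : B (u 1) (u r) = 1 := by
      rw [huu _ _ le_rfl hr hr le_rfl, if_pos (by omega)]
    have e₂ : B (v 1) (v r) = -1 := by
      rw [hvv _ _ le_rfl hr hr le_rfl, if_pos (by omega)]
    have e₃ : B (u 1) (v r) = 0 := huv _ _ le_rfl hr hr le_rfl
    have e₄ : B (v 1) (u r) = 0 := hvu _ _ le_rfl hr hr le_rfl
    simp only [map_add, map_smul, h₁, h₂, LinearMap.add_apply, LinearMap.smul_apply, smul_eq_mul,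
      e₁, e₂, e₃, e₄]
    ring
  have hmem : ∀ s t : ℝ, s • u 1 + t • v 1 ∈ tailSpan u r 0 ⊔ tailSpan v r 0 := fun s t =>
    Submodule.add_mem_sup (Submodule.smul_mem _ _ (mem_tailSpan one_pos hr))
      (Submodule.smul_mem _ _ (mem_tailSpan one_pos hr))
  have hαβ : α ^ 2 + β ^ 2 ≠ 0 := by
    intro h0
    have h1 : α = 0 := by nlinarith [sq_nonneg α, sq_nonneg β]
    have h2 : β = 0 := by nlinarith [sq_nonneg α, sq_nonneg β]
    have hc : c = 0 := by rw [← hα, h1, h2]; ring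
    have hd : d = 0 := by rw [h1] at hβ; linarith
    simp [hc, hd] at hcd
  refine hL.hasPosIndex_one hr (hmem α β) (hmem (-β) α)
    (sup_le_sup (tailSpan_anti zero_le_one) (tailSpan_anti zero_le_one)) ?_ ?_ ?_
  · intro x hx
    obtain ⟨x₁, hx₁, x₂, hx₂, rfl⟩ := Submodule.mem_sup.1 hx
    obtain ⟨s, y₁, hy₁, rfl⟩ := exists_of_mem_tailSpan hr hx₁
    obtain ⟨t, y₂, hy₂, rfl⟩ := exists_of_mem_tailSpan hr hx₂
    refine ⟨(s * α + t * β) / (α ^ 2 + β ^ 2), (t * α - s * β) / (α ^ 2 + β ^ 2), y₁ + y₂,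
      Submodule.add_mem_sup hy₁ hy₂, ?_⟩
    match_scalars <;> field_simp <;> ring
  · rw [hq, hα, hβ]
    nlinarith
  · rw [hq]
    have : c * ((-β) ^ 2 - α ^ 2) - d * (2 * -β * α) =
        -(c * (α ^ 2 - β ^ 2) - d * (2 * α * β)) := by ring
    rw [this, hα, hβ]
    nlinarith

end TailSpan

open Polynomial in
theorem IsRealBlock.exists_tailSpan {lam : ℝ} {r : ℕ} (h : IsRealBlock B T lam r ε U) :
    ∃ v : ℕ → V, U = tailSpan v r 0 ∧ B (v 1) ((aeval T (X - C lam) ^ (r - 1)) (v 1)) = ε ∧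
      IsShiftFiltration B (aeval T (X - C lam)) U r (tailSpan v r) := by
  obtain ⟨hr, hε, v, hv, hTv, hB, -, rfl⟩ := h
  have hε0 : ε ≠ 0 := by rcases hε with rfl | rfl <;> norm_num
  have hS : ∀ j, 1 ≤ j → j ≤ r → (aeval T (X - C lam)) (v j) = v (j + 1) := by
    intro j hj hjr
    simp [hTv j hj hjr, Module.algebraMap_end_apply]
  refine ⟨v, rfl, ?_, isShiftFiltration_real hε0 hv hS hB⟩
  have hpow : ∀ n, n < r → (aeval T (X - C lam) ^ n) (v 1) = v (n + 1) := by
    intro n hn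
    induction n with
    | zero => simp
    | succ n ih =>
      rw [pow_succ', Module.End.mul_apply, ih (by omega), hS _ (by omega) (by omega)]
  rw [hpow _ (by omega), hB _ _ le_rfl hr (by omega) (by omega), if_pos (by omega)]

open Polynomial in
theorem IsRealBlock.hasPosIndex_one {lam : ℝ} (h : IsRealBlock B T lam p ε U) :
    HasPosIndex B (aeval T (X - C lam)) p ε U 1 := by
  have hp := h.1
  have hε : 0 < ε * ε := by rcases h.2.1 with rfl | rfl <;> norm_num
  obtain ⟨v, rfl, hq, hL⟩ := h.exists_tailSpan
  refine hL.hasPosIndex_one hp (mem_tailSpan one_pos hp) (Submodule.zero_mem _)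
    (tailSpan_anti zero_le_one) (fun x hx => ?_) (by rwa [hq]) (by simp)
  obtain ⟨c, y, hy, rfl⟩ := exists_of_mem_tailSpan hp hx
  exact ⟨c, 0, y, hy, by simp⟩

open Polynomial in
theorem IsRealBlock.hasPosIndex_zero_of_sign_ne {lam δ : ℝ} (h : IsRealBlock B T lam p δ U)
    (hε : ε = 1 ∨ ε = -1) (hne : δ ≠ ε) :
    HasPosIndex B (aeval T (X - C lam)) p ε U 0 := by
  have hp := h.1
  have hεδ : ε * δ ≤ 0 := by
    rcases hε with rfl | rfl <;> rcases h.2.1 with rfl | rfl <;>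
      first | exact absurd rfl hne | norm_num
  obtain ⟨v, rfl, hq, hL⟩ := h.exists_tailSpan
  refine hasPosIndex_zero_of_nonpos fun x hx _ => ?_
  obtain ⟨c, y, hy, rfl⟩ := exists_of_mem_tailSpan hp hx
  rw [zero_add] at hy ⊢
  rw [hL.form_smul_add hp c (mem_tailSpan one_pos hp) hy, hq, mul_left_comm]
  exact mul_nonpos_of_nonneg_of_nonpos (sq_nonneg c) hεδ

open Polynomial in
theorem IsComplexBlock.isShiftFiltration_and_hasPosIndex_one (hsymm : ∀ x y, B x y = B y x)
    {a b : ℝ} {r : ℕ} (h : IsComplexBlock B T a b r U) :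
    (∃ L, IsShiftFiltration B (aeval T ((X - C a) ^ 2 + C (b ^ 2))) U r L) ∧
      HasPosIndex B (aeval T ((X - C a) ^ 2 + C (b ^ 2))) r 1 U 1 := by
  obtain ⟨hr, hb, u, v, hu, hv, hTu, hTv, huu, hvv, huv, -, rfl⟩ := h
  have hvu : ∀ i j, 1 ≤ i → i ≤ r → 1 ≤ j → j ≤ r → B (v i) (u j) = 0 :=
    fun i j hi hir hj hjr => by rw [hsymm, huv j i hj hjr hi hir]
  have hS : ∀ x, (aeval T ((X - C a) ^ 2 + C (b ^ 2))) x =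
      T (T x - a • x) - a • (T x - a • x) + b ^ 2 • x := by
    intro x
    simp [pow_two, Module.algebraMap_end_apply, Module.End.mul_apply, smul_smul]
  have hu' : ∀ j, 1 ≤ j → j ≤ r → ∃ w ∈ tailSpan u r (j + 1),
      T (u (j + 1)) = a • u (j + 1) - b • v (j + 1) + w := by
    intro j hj hjr
    rcases hjr.lt_or_eq with h | rfl
    · exact ⟨u (j + 2), succ_mem_tailSpan hu (by omega) h, hTu _ (by omega) h⟩
    · exact ⟨0, Submodule.zero_mem _, by simp [hu, hv]⟩
  have hv' : ∀ j, 1 ≤ j → j ≤ r → ∃ w ∈ tailSpan v r (j + 1),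
      T (v (j + 1)) = b • u (j + 1) + a • v (j + 1) + w := by
    intro j hj hjr
    rcases hjr.lt_or_eq with h | rfl
    · exact ⟨v (j + 2), succ_mem_tailSpan hv (by omega) h, hTv _ (by omega) h⟩
    · exact ⟨0, Submodule.zero_mem _, by simp [hu, hv]⟩
  have hSu : ∀ j, 1 ≤ j → j ≤ r →
      (aeval T ((X - C a) ^ 2 + C (b ^ 2))) (u j) + (2 * b) • v (j + 1) ∈
        tailSpan u r (j + 1) ⊔ tailSpan v r (j + 1) := by
    intro j hj hjr
    obtain ⟨w, hw, hTw⟩ := hu' j hj hjr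
    convert (Submodule.mem_sup_left hw : w ∈ tailSpan u r (j + 1) ⊔ tailSpan v r (j + 1)) using 1
    rw [hS]
    simp only [map_add, map_sub, map_smul, hTu j hj hjr, hTv j hj hjr, hTw]
    module
  have hSv : ∀ j, 1 ≤ j → j ≤ r →
      (aeval T ((X - C a) ^ 2 + C (b ^ 2))) (v j) - (2 * b) • u (j + 1) ∈
        tailSpan u r (j + 1) ⊔ tailSpan v r (j + 1) := by
    intro j hj hjr
    obtain ⟨w, hw, hTw⟩ := hv' j hj hjr
    convert (Submodule.mem_sup_right hw : w ∈ tailSpan u r (j + 1) ⊔ tailSpan v r (j + 1)) using 1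
    rw [hS]
    simp only [map_add, map_sub, map_smul, hTu j hj hjr, hTv j hj hjr, hTw]
    module
  rw [Submodule.span_union]
  exact ⟨⟨_, isShiftFiltration_complex hb.ne' hu hv hSu hSv huu hvv huv hvu⟩,
    hasPosIndex_one_complex hb.ne' hr hu hv hSu hSv huu hvv huv hvu⟩

/-- The data of a metric-Jordan block. -/
inductive BlockDatum
  | real (lam : ℝ) (p : ℕ) (ε : ℝ)
  | complex (a b : ℝ) (p : ℕ)

namespace BlockDatum

/-- `d.IsBlock B T U` says that `U` is a metric-Jordan block with data `d`. -/
def IsBlock (B : V →ₗ[ℝ] V →ₗ[ℝ] ℝ) (T : Module.End ℝ V) :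
    BlockDatum → Submodule ℝ V → Prop
  | real lam p ε, U => IsRealBlock B T lam p ε U
  | complex a b p, U => IsComplexBlock B T a b p U

/-- The admissibility conditions on the data of a block. -/
def Valid : BlockDatum → Prop
  | real _ p ε => 0 < p ∧ (ε = 1 ∨ ε = -1)
  | complex _ b p => 0 < p ∧ 0 < b

/-- The irreducible polynomial a power of which annihilates a block. -/
noncomputable def poly : BlockDatum → Polynomial ℝ
  | real lam _ _ => .X - .C lam
  | complex a b _ => (.X - .C a) ^ 2 + .C (b ^ 2)

/-- The length of the chains of a block. -/
def size : BlockDatum → ℕ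
  | real _ p _ => p
  | complex _ _ p => p

/-- The sign of a block, taken to be `1` for a complex block. -/
def sign : BlockDatum → ℝ
  | real _ _ ε => ε
  | complex _ _ _ => 1

theorem IsBlock.valid {d : BlockDatum} (h : d.IsBlock B T U) : d.Valid := by
  cases d with
  | real => exact ⟨h.1, h.2.1⟩
  | complex => exact ⟨h.1, h.2.1⟩

theorem Valid.size_pos {d : BlockDatum} (h : d.Valid) : 0 < d.size := by
  cases d <;> exact h.1

theorem IsBlock.exists_isShiftFiltration (hsymm : ∀ x y, B x y = B y x) {d : BlockDatum}
    (h : d.IsBlock B T U) :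
    ∃ L, IsShiftFiltration B (Polynomial.aeval T d.poly) U d.size L := by
  cases d with
  | real lam p ε =>
    obtain ⟨v, -, -, hL⟩ := IsRealBlock.exists_tailSpan h
    exact ⟨_, hL⟩
  | complex a b p => exact (IsComplexBlock.isShiftFiltration_and_hasPosIndex_one hsymm h).1

theorem IsBlock.hasPosIndex_one (hsymm : ∀ x y, B x y = B y x) {d : BlockDatum}
    (h : d.IsBlock B T U) :
    HasPosIndex B (Polynomial.aeval T d.poly) d.size d.sign U 1 := by
  cases d with
  | real lam p ε => exact IsRealBlock.hasPosIndex_one h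
  | complex a b p => exact (IsComplexBlock.isShiftFiltration_and_hasPosIndex_one hsymm h).2

open Polynomial in
theorem isCoprime_linear_quadratic (lam a : ℝ) {b : ℝ} (hb : b ≠ 0) :
    IsCoprime (X - C lam : ℝ[X]) ((X - C a) ^ 2 + C (b ^ 2)) := by
  have hc : (lam - a) ^ 2 + b ^ 2 ≠ 0 := by positivity
  refine ⟨C (-((lam - a) ^ 2 + b ^ 2)⁻¹) * (X + C (lam - 2 * a)),
    C ((lam - a) ^ 2 + b ^ 2)⁻¹, ?_⟩
  have h1 : (C ((lam - a) ^ 2 + b ^ 2)⁻¹ : ℝ[X]) * C ((lam - a) ^ 2 + b ^ 2) = 1 := by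
    rw [← C_mul, inv_mul_cancel₀ hc, C_1]
  rw [← h1]
  simp only [map_add, map_sub, map_mul, map_pow, map_neg, C_ofNat]
  ring

open Polynomial in
theorem isCoprime_quadratic_quadratic {a b a' b' : ℝ} (hb : 0 < b) (hb' : 0 < b')
    (h : ¬(a = a' ∧ b = b')) :
    IsCoprime ((X - C a) ^ 2 + C (b ^ 2) : ℝ[X]) ((X - C a') ^ 2 + C (b' ^ 2)) := by
  by_cases ha : a = a'
  · subst ha
    have hne : b' ^ 2 - b ^ 2 ≠ 0 := by
      intro h0
      have : (b' - b) * (b' + b) = 0 := by linarith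
      rcases mul_eq_zero.1 this with h1 | h1
      · exact h ⟨rfl, by linarith⟩
      · linarith
    refine ⟨C (-(b' ^ 2 - b ^ 2)⁻¹), C (b' ^ 2 - b ^ 2)⁻¹, ?_⟩
    have h1 : (C (b' ^ 2 - b ^ 2)⁻¹ : ℝ[X]) * C (b' ^ 2 - b ^ 2) = 1 := by
      rw [← C_mul, inv_mul_cancel₀ hne, C_1]
    rw [← h1]
    simp only [map_sub, map_pow, map_neg]
    ring
  · have hk : 2 * (a - a') ≠ 0 := by
      simpa [sub_eq_zero] using ha
    set μ := (a ^ 2 + b ^ 2 - a' ^ 2 - b' ^ 2) / (2 * (a - a')) with hμ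
    have hμ' : 2 * (a - a') * μ = a ^ 2 + b ^ 2 - a' ^ 2 - b' ^ 2 := by
      rw [hμ]; field_simp
    have hlin := (isCoprime_linear_quadratic μ a hb.ne').symm
    have hunit : IsUnit (C (2 * (a - a')) : ℝ[X]) := isUnit_C.2 hk.isUnit
    have hmul : IsCoprime ((X - C a) ^ 2 + C (b ^ 2) : ℝ[X]) (C (2 * (a - a')) * (X - C μ)) :=
      (isCoprime_mul_unit_left_right hunit _ _).2 hlin
    have key : ((X - C a') ^ 2 + C (b' ^ 2) : ℝ[X]) =
        C (2 * (a - a')) * (X - C μ) + ((X - C a) ^ 2 + C (b ^ 2)) * 1 := by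
      have : (C (2 * (a - a')) * (X - C μ) : ℝ[X]) =
          C (2 * (a - a')) * X - C (a ^ 2 + b ^ 2 - a' ^ 2 - b' ^ 2) := by
        rw [← hμ', mul_sub, C_mul (a := 2 * (a - a')) (b := μ)]
      rw [this]
      simp only [map_add, map_sub, map_mul, map_pow, C_ofNat]
      ring
    rw [key]
    exact hmul.add_mul_left_right 1

theorem poly_eq_or_isCoprime {d d' : BlockDatum} (h : d.Valid) (h' : d'.Valid) :
    d.poly = d'.poly ∨ IsCoprime d.poly d'.poly := by
  cases d with
  | real lam p ε =>
    cases d' with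
    | real lam' p' ε' =>
      by_cases hl : lam = lam'
      · exact .inl (by simp [poly, hl])
      · exact .inr (Polynomial.isCoprime_X_sub_C_of_isUnit_sub (sub_ne_zero.2 hl).isUnit)
    | complex a b p' => exact .inr (isCoprime_linear_quadratic lam a h'.2.ne')
  | complex a b p =>
    cases d' with
    | real lam' p' ε' => exact .inr (isCoprime_linear_quadratic lam' a h.2.ne').symm
    | complex a' b' p' =>
      by_cases hab : a = a' ∧ b = b'
      · exact .inl (by simp [poly, hab])
      · exact .inr (isCoprime_quadratic_quadratic h.2 h'.2 hab)

theorem eq_or_sign_ne_of_poly_eq {d d' : BlockDatum} (h : d.Valid) (h' : d'.Valid)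
    (hpoly : d.poly = d'.poly) (hsize : d.size = d'.size) :
    d = d' ∨ ∃ lam p ε ε', d = real lam p ε ∧ d' = real lam p ε' ∧ ε ≠ ε' := by
  cases d with
  | real lam p ε =>
    cases d' with
    | real lam' p' ε' =>
      obtain rfl : p = p' := hsize
      obtain rfl : lam = lam' := by simpa [poly] using hpoly
      by_cases hε : ε = ε'
      · exact .inl (by rw [hε])
      · exact .inr ⟨_, _, _, _, rfl, rfl, hε⟩
    | complex a b p' =>
      have := congrArg (Polynomial.eval lam) hpoly
      have hb : 0 < b := h'.2
      simp only [poly, Polynomial.eval_sub, Polynomial.eval_add, Polynomial.eval_pow,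
        Polynomial.eval_X, Polynomial.eval_C] at this
      nlinarith [sq_nonneg (lam - a), pow_pos hb 2]
  | complex a b p =>
    cases d' with
    | real lam p' ε' =>
      have := congrArg (Polynomial.eval lam) hpoly
      have hb : 0 < b := h.2
      simp only [poly, Polynomial.eval_sub, Polynomial.eval_add, Polynomial.eval_pow,
        Polynomial.eval_X, Polynomial.eval_C] at this
      nlinarith [sq_nonneg (lam - a), pow_pos hb 2]
    | complex a' b' p' =>
      obtain rfl : p = p' := hsize
      by_cases hab : a = a' ∧ b = b'
      · exact .inl (by rw [hab.1, hab.2])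
      · exfalso
        have hco := isCoprime_quadratic_quadratic h.2 h'.2 hab
        have heq : (Polynomial.X - Polynomial.C a) ^ 2 + Polynomial.C (b ^ 2) =
          (Polynomial.X - Polynomial.C a') ^ 2 + Polynomial.C (b' ^ 2) := hpoly
        rw [← heq, isCoprime_self] at hco
        have hdeg := Polynomial.natDegree_eq_zero_of_isUnit hco
        have : ((Polynomial.X - Polynomial.C a) ^ 2 + Polynomial.C (b ^ 2)).natDegree = 2 := by
          compute_degree!
        omega

theorem IsBlock.hasPosIndex_zero (hsymm : ∀ x y, B x y = B y x) {d d' : BlockDatum}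
    (h : d.IsBlock B T U) (h' : d'.Valid) (hne : d ≠ d') :
    HasPosIndex B (Polynomial.aeval T d'.poly) d'.size d'.sign U 0 := by
  obtain ⟨L, hL⟩ := h.exists_isShiftFiltration hsymm
  rcases poly_eq_or_isCoprime h.valid h' with hpoly | hco
  · by_cases hsize : d.size = d'.size
    · rcases eq_or_sign_ne_of_poly_eq h.valid h' hpoly hsize with
        rfl | ⟨lam, p, ε, ε', rfl, rfl, hε⟩
      · exact absurd rfl hne
      · exact IsRealBlock.hasPosIndex_zero_of_sign_ne h h'.2 hε
    · rw [← hpoly]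
      exact hL.hasPosIndex_zero h'.size_pos hsize
  · exact hasPosIndex_zero_of_isCoprime hco.symm fun x hx => hL.pow_eq_zero hx

theorem IsBlock.unique [FiniteDimensional ℝ V] (hsymm : ∀ x y, B x y = B y x) {d d' : BlockDatum}
    (h : d.IsBlock B T U) (h' : d'.IsBlock B T U) : d = d' := by
  by_contra hne
  exact one_ne_zero ((h'.hasPosIndex_one hsymm).unique (h.hasPosIndex_zero hsymm h'.valid hne))

end BlockDatum

theorem IsMetricJordanDecomposition.exists_isBlock {k : ℕ} {W : Fin k → Submodule ℝ V}
    (hW : IsMetricJordanDecomposition B T W) (i : Fin k) :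
    ∃ d : BlockDatum, d.IsBlock B T (W i) := by
  rcases hW.2.2.2.2 i with ⟨lam, p, ε, h⟩ | ⟨a, b, p, h⟩
  · exact ⟨.real lam p ε, h⟩
  · exact ⟨.complex a b p, h⟩

theorem IsMetricJordanDecomposition.hasPosIndex_top [FiniteDimensional ℝ V]
    (hsymm : ∀ x y, B x y = B y x) {k : ℕ} {W : Fin k → Submodule ℝ V}
    (hW : IsMetricJordanDecomposition B T W) {d : BlockDatum} (hd : d.Valid) :
    HasPosIndex B (Polynomial.aeval T d.poly) d.size d.sign ⊤
      (Nat.card {i : Fin k // d.IsBlock B T (W i)}) := by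
  classical
  obtain ⟨htop, hind, horth, hinv, -⟩ := id hW
  have hinv' : ∀ i, ∀ x ∈ W i, Polynomial.aeval T d.poly x ∈ W i := fun i x hx =>
    Polynomial.aeval_apply_smul_mem_of_le_comap hx d.poly T (hinv i)
  have hn : ∀ i, HasPosIndex B (Polynomial.aeval T d.poly) d.size d.sign (W i)
      (if d.IsBlock B T (W i) then 1 else 0) := by
    intro i
    split_ifs with h
    · exact h.hasPosIndex_one hsymm
    · obtain ⟨d', hd'⟩ := hW.exists_isBlock i
      exact hd'.hasPosIndex_zero hsymm hd (by rintro rfl; exact h hd')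
  have := hasPosIndex_biSup hind horth hinv' hn Finset.univ
  rw [Nat.card_eq_fintype_card, Fintype.card_subtype, Finset.card_filter]
  simpa [htop] using this

theorem IsMetricJordanDecomposition.card_isBlock_eq [FiniteDimensional ℝ V]
    (hsymm : ∀ x y, B x y = B y x) {k m : ℕ} {W : Fin k → Submodule ℝ V}
    {W' : Fin m → Submodule ℝ V} (hW : IsMetricJordanDecomposition B T W)
    (hW' : IsMetricJordanDecomposition B T W') (d : BlockDatum) :
    Nat.card {i : Fin k // d.IsBlock B T (W i)} =
      Nat.card {j : Fin m // d.IsBlock B T (W' j)} := by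
  by_cases hd : d.Valid
  · exact (hW.hasPosIndex_top hsymm hd).unique (hW'.hasPosIndex_top hsymm hd)
  · have : IsEmpty {i : Fin k // d.IsBlock B T (W i)} := ⟨fun i => hd i.2.valid⟩
    have : IsEmpty {j : Fin m // d.IsBlock B T (W' j)} := ⟨fun j => hd j.2.valid⟩
    simp

theorem IsMetricJordanDecomposition.length_eq [FiniteDimensional ℝ V]
    (hsymm : ∀ x y, B x y = B y x) {k m : ℕ} {W : Fin k → Submodule ℝ V}
    {W' : Fin m → Submodule ℝ V} (hW : IsMetricJordanDecomposition B T W)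
    (hW' : IsMetricJordanDecomposition B T W') : k = m := by
  choose f hf using hW.exists_isBlock
  choose g hg using hW'.exists_isBlock
  have hf' : ∀ d i, f i = d ↔ d.IsBlock B T (W i) := fun d i =>
    ⟨fun h => h ▸ hf i, fun h => (hf i).unique hsymm h⟩
  have hg' : ∀ d j, g j = d ↔ d.IsBlock B T (W' j) := fun d j =>
    ⟨fun h => h ▸ hg j, fun h => (hg j).unique hsymm h⟩
  have e : ∀ d, {i // f i = d} ≃ {j // g j = d} := fun d =>
    Classical.choice <| Finite.card_eq.1 <| by
      simpa only [hf', hg'] using hW.card_isBlock_eq hsymm hW' d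
  exact Fin.equiv_iff_eq.1 ⟨(Equiv.sigmaFiberEquiv f).symm.trans
    ((Equiv.sigmaCongrRight e).trans (Equiv.sigmaFiberEquiv g))⟩

/-- **Uniqueness of the metric-Jordan canonical form.**
If `V = V₁ ⊥ ⋯ ⊥ V_k` and `V = W₁ ⊥ ⋯ ⊥ W_m` are two metric-Jordan decompositions for
a self-adjoint operator `T`, then for every real datum `(lam, p, ε)` the number of `i`
with `V i` a real block of that datum equals the number of `j` with `W j` a real block
of that datum, and likewise for every complex datum `(a, b, p)` with `b > 0`.  In
particular `k = m`. -/
theorem metric_jordan_decomposition_unique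
    [FiniteDimensional ℝ V]
    (B : V →ₗ[ℝ] V →ₗ[ℝ] ℝ) (hsymm : ∀ x y, B x y = B y x)
    (hnondeg : ∀ x, (∀ y, B x y = 0) → x = 0)
    (T : Module.End ℝ V) (hT : ∀ x y, B (T x) y = B x (T y))
    (k m : ℕ) (Vb : Fin k → Submodule ℝ V) (Wb : Fin m → Submodule ℝ V)
    (hV : IsMetricJordanDecomposition B T Vb)
    (hW : IsMetricJordanDecomposition B T Wb) :
    (∀ (lam : ℝ) (p : ℕ) (ε : ℝ), 1 ≤ p → (ε = 1 ∨ ε = -1) →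
      Nat.card {i : Fin k // IsRealBlock B T lam p ε (Vb i)} =
        Nat.card {j : Fin m // IsRealBlock B T lam p ε (Wb j)}) ∧
    (∀ (a b : ℝ) (p : ℕ), 0 < b → 1 ≤ p →
      Nat.card {i : Fin k // IsComplexBlock B T a b p (Vb i)} =
        Nat.card {j : Fin m // IsComplexBlock B T a b p (Wb j)}) ∧
    k = m := by
  exact ⟨fun lam p ε _ _ => hV.card_isBlock_eq hsymm hW (.real lam p ε),
    fun a b p _ _ => hV.card_isBlock_eq hsymm hW (.complex a b p), hV.length_eq hsymm hW⟩

end MetricJordan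
end

section
/- Let V be a real scalar product space and S, T self-adjoint linear operators on V. Then there exists an invertible linear map R : V → V with ⟨Rx, Ry⟩ = ⟨x,y⟩ for all x,y ∈ V and T = R ∘ S ∘ R⁻¹ if and only if S and T admit metric-Jordan decompositions with the same multiset of block data, i.e. there are decompositions V = V_1 ⊥ ⋯ ⊥ V_k for S and V = W_1 ⊥ ⋯ ⊥ W_k for T such that for each real datum (λ, p, ε) and each complex datum (a, b, p) with b > 0, the number of V_i of that type for S equals the number of W_j of that type for T. -/
section MetricJordan

variable {V : Type*} [AddCommGroup V] [Module ℝ V]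

variable {V' : Type*} [AddCommGroup V'] [Module ℝ V']

theorem gram_pairing {ι : Type*} [Fintype ι] [DecidableEq ι] {B : V →ₗ[ℝ] V →ₗ[ℝ] ℝ}
    {e : ι → V} {d : ι → ι} (hd : d.Injective) {s : ι → ℝ}
    (h : ∀ i j, B (e i) (e j) = if j = d i then s i else 0) (c : ι → ℝ) (i : ι) :
    B (∑ j, c j • e j) (e (d i)) = c i * s i := by
  simp [map_sum, LinearMap.sum_apply, h, hd.eq_iff]

theorem linearIndependent_of_gram {ι : Type*} [Fintype ι] [DecidableEq ι]
    {B : V →ₗ[ℝ] V →ₗ[ℝ] ℝ} {e : ι → V} {d : ι → ι} (hd : d.Injective) {s : ι → ℝ}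
    (hs : ∀ i, s i ≠ 0) (h : ∀ i j, B (e i) (e j) = if j = d i then s i else 0) :
    LinearIndependent ℝ e := by
  rw [Fintype.linearIndependent_iff]
  intro c hc i
  have := gram_pairing hd h c i
  rw [hc] at this
  simpa [hs i] using this

theorem eq_zero_of_gram {ι : Type*} [Fintype ι] [DecidableEq ι]
    {B : V →ₗ[ℝ] V →ₗ[ℝ] ℝ} {e : ι → V} {d : ι → ι} (hd : d.Injective) {s : ι → ℝ}
    (hs : ∀ i, s i ≠ 0) (h : ∀ i j, B (e i) (e j) = if j = d i then s i else 0)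
    {x : V} (hx : x ∈ Submodule.span ℝ (Set.range e))
    (h0 : ∀ y ∈ Submodule.span ℝ (Set.range e), B x y = 0) : x = 0 := by
  obtain ⟨c, rfl⟩ := (Submodule.mem_span_range_iff_exists_fun ℝ).1 hx
  have hc : ∀ i, c i = 0 := fun i => by
    have := gram_pairing hd h c i
    rw [h0 _ (Submodule.subset_span ⟨_, rfl⟩)] at this
    simpa [hs i] using this.symm
  simp [hc]

theorem bilin_map_eqOn_span {B : V →ₗ[ℝ] V →ₗ[ℝ] ℝ} {B' : V' →ₗ[ℝ] V' →ₗ[ℝ] ℝ}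
    {f : V →ₗ[ℝ] V'} {s : Set V} (h : ∀ x ∈ s, ∀ y ∈ s, B' (f x) (f y) = B x y) :
    ∀ x ∈ Submodule.span ℝ s, ∀ y ∈ Submodule.span ℝ s, B' (f x) (f y) = B x y := by
  intro x hx y hy
  induction hx, hy using Submodule.span_induction₂ with
  | mem_mem x y hx hy => exact h x hx y hy
  | zero_left => simp
  | zero_right => simp
  | add_left x y z _ _ _ h1 h2 => simp [h1, h2]
  | add_right x y z _ _ _ h1 h2 => simp [h1, h2]
  | smul_left r x y _ _ h => simp [h]
  | smul_right r x y _ _ h => simp [h]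

theorem exists_linearMap_of_linearIndependent {ι : Type*} {e : ι → V}
    (he : LinearIndependent ℝ e) (w : ι → V') : ∃ f : V →ₗ[ℝ] V', ∀ i, f (e i) = w i := by
  obtain ⟨f, hf⟩ := LinearMap.exists_extend ((Module.Basis.span he).constr ℝ w)
  refine ⟨f, fun i => ?_⟩
  have := LinearMap.congr_fun hf (Module.Basis.span he i)
  rw [Module.Basis.constr_basis] at this
  rw [← this]
  simp [Module.Basis.span_apply]

theorem image_Icc_eq_range {α : Type*} (v : ℕ → α) (p : ℕ) :
    v '' Set.Icc 1 p = Set.range (fun i : Fin p => v (i + 1)) := by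
  ext x
  constructor
  · rintro ⟨j, ⟨h1, h2⟩, rfl⟩
    exact ⟨⟨j - 1, by omega⟩, by simp [Nat.sub_add_cancel h1]⟩
  · rintro ⟨i, rfl⟩
    exact ⟨i + 1, ⟨by omega, by omega⟩, rfl⟩

theorem real_chain_gram {B : V →ₗ[ℝ] V →ₗ[ℝ] ℝ} {v : ℕ → V} {p : ℕ} {ε : ℝ}
    (h : ∀ i j, 1 ≤ i → i ≤ p → 1 ≤ j → j ≤ p →
      B (v i) (v j) = if i + j = p + 1 then ε else 0) (i j : Fin p) :
    B (v (i + 1)) (v (j + 1)) = if j = Fin.rev i then ε else 0 := by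
  rw [h _ _ (by omega) (by omega) (by omega) (by omega)]
  congr 1
  rw [Fin.ext_iff, Fin.val_rev, eq_iff_iff]
  omega

theorem complex_chain_gram {B : V →ₗ[ℝ] V →ₗ[ℝ] ℝ} {u v : ℕ → V} {p : ℕ}
    (hsymm : ∀ x y, B x y = B y x)
    (hu : ∀ i j, 1 ≤ i → i ≤ p → 1 ≤ j → j ≤ p →
      B (u i) (u j) = if i + j = p + 1 then 1 else 0)
    (hv : ∀ i j, 1 ≤ i → i ≤ p → 1 ≤ j → j ≤ p →
      B (v i) (v j) = if i + j = p + 1 then -1 else 0)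
    (huv : ∀ i j, 1 ≤ i → i ≤ p → 1 ≤ j → j ≤ p → B (u i) (v j) = 0) (i j : Fin p ⊕ Fin p) :
    B (Sum.elim (fun i : Fin p => u (i + 1)) (fun i : Fin p => v (i + 1)) i)
      (Sum.elim (fun i : Fin p => u (i + 1)) (fun i : Fin p => v (i + 1)) j) =
      if j = Sum.map Fin.rev Fin.rev i then Sum.elim (fun _ => (1 : ℝ)) (fun _ => -1) i
      else 0 := by
  rcases i with i | i <;> rcases j with j | j
  · simpa using real_chain_gram hu i j
  · simpa using huv _ _ (by omega) (by omega) (by omega) (by omega)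
  · rw [hsymm]
    simpa using huv _ _ (by omega) (by omega) (by omega) (by omega)
  · simpa using real_chain_gram hv i j

theorem sumRev_injective (p : ℕ) :
    (Sum.map (Fin.rev : Fin p → Fin p) (Fin.rev : Fin p → Fin p)).Injective :=
  Fin.rev_injective.sumMap Fin.rev_injective

theorem sumSign_ne_zero {p : ℕ} (i : Fin p ⊕ Fin p) :
    Sum.elim (fun _ => (1 : ℝ)) (fun _ => -1) i ≠ 0 := by
  rcases i with i | i <;> simp

theorem sign_ne_zero_of_eq {ε : ℝ} (h : ε = 1 ∨ ε = -1) : ε ≠ 0 := by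
  rcases h with rfl | rfl <;> norm_num

theorem IsRealBlock.of_chain {B : V →ₗ[ℝ] V →ₗ[ℝ] ℝ} {T : Module.End ℝ V} {lam : ℝ} {p : ℕ}
    {ε : ℝ} {v : ℕ → V} (hp : 0 < p) (hε : ε = 1 ∨ ε = -1) (h0 : v (p + 1) = 0)
    (hT : ∀ j, 1 ≤ j → j ≤ p → T (v j) = lam • v j + v (j + 1))
    (hB : ∀ i j, 1 ≤ i → i ≤ p → 1 ≤ j → j ≤ p →
      B (v i) (v j) = if i + j = p + 1 then ε else 0) :
    IsRealBlock B T lam p ε (Submodule.span ℝ (v '' Set.Icc 1 p)) :=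
  ⟨hp, hε, v, h0, hT, hB, linearIndependent_of_gram Fin.rev_injective
    (fun _ => sign_ne_zero_of_eq hε) (real_chain_gram hB), rfl⟩

theorem IsComplexBlock.of_chain {B : V →ₗ[ℝ] V →ₗ[ℝ] ℝ} {T : Module.End ℝ V} {a b : ℝ} {p : ℕ}
    {u v : ℕ → V} (hsymm : ∀ x y, B x y = B y x)
    (hp : 0 < p) (hb : 0 < b) (hu0 : u (p + 1) = 0) (hv0 : v (p + 1) = 0)
    (hTu : ∀ j, 1 ≤ j → j ≤ p → T (u j) = a • u j - b • v j + u (j + 1))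
    (hTv : ∀ j, 1 ≤ j → j ≤ p → T (v j) = b • u j + a • v j + v (j + 1))
    (hu : ∀ i j, 1 ≤ i → i ≤ p → 1 ≤ j → j ≤ p →
      B (u i) (u j) = if i + j = p + 1 then 1 else 0)
    (hv : ∀ i j, 1 ≤ i → i ≤ p → 1 ≤ j → j ≤ p →
      B (v i) (v j) = if i + j = p + 1 then -1 else 0)
    (huv : ∀ i j, 1 ≤ i → i ≤ p → 1 ≤ j → j ≤ p → B (u i) (v j) = 0) :
    IsComplexBlock B T a b p (Submodule.span ℝ (u '' Set.Icc 1 p ∪ v '' Set.Icc 1 p)) :=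
  ⟨hp, hb, u, v, hu0, hv0, hTu, hTv, hu, hv, huv, linearIndependent_of_gram (sumRev_injective p)
    sumSign_ne_zero (complex_chain_gram hsymm hu hv huv), rfl⟩

theorem IsRealBlock.nondegenerate {B : V →ₗ[ℝ] V →ₗ[ℝ] ℝ} {T : Module.End ℝ V} {lam : ℝ} {p : ℕ}
    {ε : ℝ} {W : Submodule ℝ V} (h : IsRealBlock B T lam p ε W) :
    ∀ x ∈ W, (∀ y ∈ W, B x y = 0) → x = 0 := by
  obtain ⟨-, hε, v, -, -, hB, -, rfl⟩ := h
  rw [image_Icc_eq_range]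
  exact fun x hx h0 => eq_zero_of_gram Fin.rev_injective (fun _ => sign_ne_zero_of_eq hε)
    (real_chain_gram hB) hx h0

theorem IsComplexBlock.nondegenerate {B : V →ₗ[ℝ] V →ₗ[ℝ] ℝ} {T : Module.End ℝ V} {a b : ℝ}
    {p : ℕ} {W : Submodule ℝ V} (hsymm : ∀ x y, B x y = B y x)
    (h : IsComplexBlock B T a b p W) :
    ∀ x ∈ W, (∀ y ∈ W, B x y = 0) → x = 0 := by
  obtain ⟨-, -, u, v, -, -, -, -, hu, hv, huv, -, rfl⟩ := h
  rw [image_Icc_eq_range, image_Icc_eq_range, ← Set.Sum.elim_range]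
  exact fun x hx h0 => eq_zero_of_gram (sumRev_injective p) sumSign_ne_zero
    (complex_chain_gram hsymm hu hv huv) hx h0

theorem IsRealBlock.invariant {B : V →ₗ[ℝ] V →ₗ[ℝ] ℝ} {T : Module.End ℝ V} {lam : ℝ} {p : ℕ}
    {ε : ℝ} {W : Submodule ℝ V} (h : IsRealBlock B T lam p ε W) : ∀ x ∈ W, T x ∈ W := by
  obtain ⟨-, -, v, h0, hT, -, -, rfl⟩ := h
  have hmem : ∀ j, 1 ≤ j → j ≤ p + 1 → v j ∈ Submodule.span ℝ (v '' Set.Icc 1 p) := by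
    intro j h1 h2
    rcases h2.lt_or_eq with h2 | rfl
    · exact Submodule.subset_span ⟨j, ⟨h1, by omega⟩, rfl⟩
    · simp [h0]
  suffices Submodule.span ℝ (v '' Set.Icc 1 p) ≤ (Submodule.span ℝ (v '' Set.Icc 1 p)).comap T from
    this
  rw [Submodule.span_le]
  rintro _ ⟨j, ⟨h1, h2⟩, rfl⟩
  rw [SetLike.mem_coe, Submodule.mem_comap, hT j h1 h2]
  exact add_mem (Submodule.smul_mem _ _ (hmem j h1 (by omega))) (hmem _ (by omega) (by omega))

theorem IsComplexBlock.invariant {B : V →ₗ[ℝ] V →ₗ[ℝ] ℝ} {T : Module.End ℝ V} {a b : ℝ}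
    {p : ℕ} {W : Submodule ℝ V} (h : IsComplexBlock B T a b p W) : ∀ x ∈ W, T x ∈ W := by
  obtain ⟨-, -, u, v, hu0, hv0, hTu, hTv, -, -, -, -, rfl⟩ := h
  set W := Submodule.span ℝ (u '' Set.Icc 1 p ∪ v '' Set.Icc 1 p) with hW
  have hmemu : ∀ j, 1 ≤ j → j ≤ p + 1 → u j ∈ W := by
    intro j h1 h2
    rcases h2.lt_or_eq with h2 | rfl
    · exact Submodule.subset_span (Or.inl ⟨j, ⟨h1, by omega⟩, rfl⟩)
    · simp [hu0]
  have hmemv : ∀ j, 1 ≤ j → j ≤ p + 1 → v j ∈ W := by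
    intro j h1 h2
    rcases h2.lt_or_eq with h2 | rfl
    · exact Submodule.subset_span (Or.inr ⟨j, ⟨h1, by omega⟩, rfl⟩)
    · simp [hv0]
  suffices W ≤ W.comap T from this
  conv_lhs => rw [hW]
  rw [Submodule.span_le]
  rintro _ (⟨j, ⟨h1, h2⟩, rfl⟩ | ⟨j, ⟨h1, h2⟩, rfl⟩)
  · rw [SetLike.mem_coe, Submodule.mem_comap, hTu j h1 h2]
    exact add_mem (sub_mem (W.smul_mem _ (hmemu j h1 (by omega)))
      (W.smul_mem _ (hmemv j h1 (by omega)))) (hmemu _ (by omega) (by omega))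
  · rw [SetLike.mem_coe, Submodule.mem_comap, hTv j h1 h2]
    exact add_mem (add_mem (W.smul_mem _ (hmemu j h1 (by omega)))
      (W.smul_mem _ (hmemv j h1 (by omega)))) (hmemv _ (by omega) (by omega))

theorem IsRealBlock.map {B : V →ₗ[ℝ] V →ₗ[ℝ] ℝ} {T : Module.End ℝ V}
    {B' : V' →ₗ[ℝ] V' →ₗ[ℝ] ℝ} {T' : Module.End ℝ V'} {lam : ℝ} {p : ℕ} {ε : ℝ}
    {W : Submodule ℝ V} (h : IsRealBlock B T lam p ε W) (f : V →ₗ[ℝ] V')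
    (hB : ∀ x ∈ W, ∀ y ∈ W, B' (f x) (f y) = B x y) (hT : ∀ x ∈ W, T' (f x) = f (T x)) :
    IsRealBlock B' T' lam p ε (W.map f) := by
  obtain ⟨hp, hε, v, h0, hTv, hBv, -, rfl⟩ := h
  have hmem : ∀ j, 1 ≤ j → j ≤ p → v j ∈ Submodule.span ℝ (v '' Set.Icc 1 p) :=
    fun j h1 h2 => Submodule.subset_span ⟨j, ⟨h1, h2⟩, rfl⟩
  have := IsRealBlock.of_chain (B := B') (T := T') (lam := lam) (v := f ∘ v) hp hε (by simp [h0])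
    (fun j h1 h2 => by simp [hT _ (hmem j h1 h2), hTv j h1 h2])
    (fun i j h1 h2 h3 h4 => by
      rw [← hBv i j h1 h2 h3 h4, ← hB _ (hmem i h1 h2) _ (hmem j h3 h4)]; rfl)
  rwa [Set.image_comp, ← Submodule.map_span] at this

theorem IsComplexBlock.map {B : V →ₗ[ℝ] V →ₗ[ℝ] ℝ} {T : Module.End ℝ V}
    {B' : V' →ₗ[ℝ] V' →ₗ[ℝ] ℝ} {T' : Module.End ℝ V'} {a b : ℝ} {p : ℕ}
    {W : Submodule ℝ V} (hsymm : ∀ x y, B' x y = B' y x)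
    (h : IsComplexBlock B T a b p W) (f : V →ₗ[ℝ] V')
    (hB : ∀ x ∈ W, ∀ y ∈ W, B' (f x) (f y) = B x y) (hT : ∀ x ∈ W, T' (f x) = f (T x)) :
    IsComplexBlock B' T' a b p (W.map f) := by
  obtain ⟨hp, hb, u, v, hu0, hv0, hTu, hTv, hu, hv, huv, -, rfl⟩ := h
  set W := Submodule.span ℝ (u '' Set.Icc 1 p ∪ v '' Set.Icc 1 p) with hW
  have hmemu : ∀ j, 1 ≤ j → j ≤ p → u j ∈ W :=
    fun j h1 h2 => Submodule.subset_span (Or.inl ⟨j, ⟨h1, h2⟩, rfl⟩)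
  have hmemv : ∀ j, 1 ≤ j → j ≤ p → v j ∈ W :=
    fun j h1 h2 => Submodule.subset_span (Or.inr ⟨j, ⟨h1, h2⟩, rfl⟩)
  have := IsComplexBlock.of_chain (B := B') (T := T') (a := a) (b := b) (u := f ∘ u) (v := f ∘ v)
    hsymm hp hb (by simp [hu0]) (by simp [hv0])
    (fun j h1 h2 => by simp [hT _ (hmemu j h1 h2), hTu j h1 h2])
    (fun j h1 h2 => by simp [hT _ (hmemv j h1 h2), hTv j h1 h2])
    (fun i j h1 h2 h3 h4 => by
      rw [← hu i j h1 h2 h3 h4, ← hB _ (hmemu i h1 h2) _ (hmemu j h3 h4)]; rfl)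
    (fun i j h1 h2 h3 h4 => by
      rw [← hv i j h1 h2 h3 h4, ← hB _ (hmemv i h1 h2) _ (hmemv j h3 h4)]; rfl)
    (fun i j h1 h2 h3 h4 => by
      rw [← huv i j h1 h2 h3 h4, ← hB _ (hmemu i h1 h2) _ (hmemv j h3 h4)]; rfl)
  rwa [Set.image_comp, Set.image_comp, ← Set.image_union, ← Submodule.map_span] at this

/-- Blocks with the same data are related by an isometry intertwining the operators. -/
theorem IsRealBlock.exists_map_eq {B : V →ₗ[ℝ] V →ₗ[ℝ] ℝ} {T : Module.End ℝ V}
    {B' : V' →ₗ[ℝ] V' →ₗ[ℝ] ℝ} {T' : Module.End ℝ V'} {lam : ℝ} {p : ℕ} {ε : ℝ}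
    {W : Submodule ℝ V} {W' : Submodule ℝ V'}
    (h : IsRealBlock B T lam p ε W) (h' : IsRealBlock B' T' lam p ε W') :
    ∃ f : V →ₗ[ℝ] V', W.map f = W' ∧ (∀ x ∈ W, ∀ y ∈ W, B' (f x) (f y) = B x y) ∧
      ∀ x ∈ W, T' (f x) = f (T x) := by
  obtain ⟨-, -, v, h0, hT, hB, hli, rfl⟩ := h
  obtain ⟨-, -, v', h0', hT', hB', -, rfl⟩ := h'
  obtain ⟨f, hf⟩ := exists_linearMap_of_linearIndependent hli (fun i => v' (i + 1))
  have hfv : ∀ j, 1 ≤ j → j ≤ p + 1 → f (v j) = v' j := by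
    intro j h1 h2
    rcases h2.lt_or_eq with h2 | rfl
    · simpa [Nat.sub_add_cancel h1] using hf ⟨j - 1, by omega⟩
    · simp [h0, h0']
  refine ⟨f, ?_, bilin_map_eqOn_span ?_, LinearMap.eqOn_span (f := T' ∘ₗ f) (g := f ∘ₗ T) ?_⟩
  · rw [Submodule.map_span, ← Set.image_comp]
    congr 1
    exact Set.image_congr fun j hj => hfv j hj.1 (by have := hj.2; omega)
  · rintro _ ⟨i, ⟨h1, h2⟩, rfl⟩ _ ⟨j, ⟨h3, h4⟩, rfl⟩
    rw [hfv i h1 (by omega), hfv j h3 (by omega), hB i j h1 h2 h3 h4, hB' i j h1 h2 h3 h4]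
  · rintro _ ⟨j, ⟨h1, h2⟩, rfl⟩
    simp [hT j h1 h2, hfv j h1 (by omega), hfv (j + 1) (by omega) (by omega), hT' j h1 h2]

/-- Blocks with the same data are related by an isometry intertwining the operators. -/
theorem IsComplexBlock.exists_map_eq {B : V →ₗ[ℝ] V →ₗ[ℝ] ℝ} {T : Module.End ℝ V}
    {B' : V' →ₗ[ℝ] V' →ₗ[ℝ] ℝ} {T' : Module.End ℝ V'} {a b : ℝ} {p : ℕ}
    {W : Submodule ℝ V} {W' : Submodule ℝ V'}
    (hsymm : ∀ x y, B x y = B y x) (hsymm' : ∀ x y, B' x y = B' y x)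
    (h : IsComplexBlock B T a b p W) (h' : IsComplexBlock B' T' a b p W') :
    ∃ f : V →ₗ[ℝ] V', W.map f = W' ∧ (∀ x ∈ W, ∀ y ∈ W, B' (f x) (f y) = B x y) ∧
      ∀ x ∈ W, T' (f x) = f (T x) := by
  obtain ⟨-, -, u, v, hu0, hv0, hTu, hTv, hu, hv, huv, hli, rfl⟩ := h
  obtain ⟨-, -, u', v', hu0', hv0', hTu', hTv', hu', hv', huv', -, rfl⟩ := h'
  obtain ⟨f, hf⟩ := exists_linearMap_of_linearIndependent hli
    (Sum.elim (fun i : Fin p => u' (i + 1)) (fun i : Fin p => v' (i + 1)))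
  have hfu : ∀ j, 1 ≤ j → j ≤ p + 1 → f (u j) = u' j := by
    intro j h1 h2
    rcases h2.lt_or_eq with h2 | rfl
    · simpa [Nat.sub_add_cancel h1] using hf (Sum.inl ⟨j - 1, by omega⟩)
    · simp [hu0, hu0']
  have hfv : ∀ j, 1 ≤ j → j ≤ p + 1 → f (v j) = v' j := by
    intro j h1 h2
    rcases h2.lt_or_eq with h2 | rfl
    · simpa [Nat.sub_add_cancel h1] using hf (Sum.inr ⟨j - 1, by omega⟩)
    · simp [hv0, hv0']
  refine ⟨f, ?_, bilin_map_eqOn_span ?_, LinearMap.eqOn_span (f := T' ∘ₗ f) (g := f ∘ₗ T) ?_⟩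
  · rw [Submodule.map_span, Set.image_union, ← Set.image_comp, ← Set.image_comp]
    congr 2
    · exact Set.image_congr fun j hj => hfu j hj.1 (by have := hj.2; omega)
    · exact Set.image_congr fun j hj => hfv j hj.1 (by have := hj.2; omega)
  · rintro _ (⟨i, ⟨h1, h2⟩, rfl⟩ | ⟨i, ⟨h1, h2⟩, rfl⟩) _
      (⟨j, ⟨h3, h4⟩, rfl⟩ | ⟨j, ⟨h3, h4⟩, rfl⟩)
    · rw [hfu i h1 (by omega), hfu j h3 (by omega), hu i j h1 h2 h3 h4, hu' i j h1 h2 h3 h4]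
    · rw [hfu i h1 (by omega), hfv j h3 (by omega), huv i j h1 h2 h3 h4, huv' i j h1 h2 h3 h4]
    · rw [hfv i h1 (by omega), hfu j h3 (by omega), hsymm, hsymm', huv j i h3 h4 h1 h2,
        huv' j i h3 h4 h1 h2]
    · rw [hfv i h1 (by omega), hfv j h3 (by omega), hv i j h1 h2 h3 h4, hv' i j h1 h2 h3 h4]
  · rintro _ (⟨j, ⟨h1, h2⟩, rfl⟩ | ⟨j, ⟨h1, h2⟩, rfl⟩)
    · simp [hTu j h1 h2, hfu j h1 (by omega), hfv j h1 (by omega),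
        hfu (j + 1) (by omega) (by omega), hTu' j h1 h2]
    · simp [hTv j h1 h2, hfu j h1 (by omega), hfv j h1 (by omega),
        hfv (j + 1) (by omega) (by omega), hTv' j h1 h2]

theorem apply_pow_left {B : V →ₗ[ℝ] V →ₗ[ℝ] ℝ} {N : Module.End ℝ V}
    (hN : ∀ x y, B (N x) y = B x (N y)) (k : ℕ) :
    ∀ x y, B ((N ^ k) x) y = B x ((N ^ k) y) := by
  induction k with
  | zero => simp
  | succ k ih =>
    intro x y
    rw [pow_succ, Module.End.mul_apply, ih, hN, ← Module.End.mul_apply, ← pow_succ', ← pow_succ]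

theorem pow_mem_of_invariant {N : Module.End ℝ V} {E : Submodule ℝ V}
    (hE : ∀ x ∈ E, N x ∈ E) (k : ℕ) : ∀ x ∈ E, (N ^ k) x ∈ E := by
  induction k with
  | zero => simp
  | succ k ih => intro x hx; rw [pow_succ, Module.End.mul_apply]; exact ih _ (hE x hx)

theorem pow_apply_eq_zero_of_lt {N : Module.End ℝ V} {q k : ℕ} {x : V}
    (hx : (N ^ (q + 1)) x = 0) (hk : q < k) : (N ^ k) x = 0 := by
  obtain ⟨l, rfl⟩ := Nat.exists_eq_add_of_le (Nat.succ_le_of_lt hk)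
  rw [Nat.succ_eq_add_one, add_comm, pow_add, Module.End.mul_apply, hx, map_zero]

/-- A nilpotent self-adjoint operator on a nonzero nondegenerate invariant subspace has a vector
on which the top power of the operator takes a nonzero value. -/
theorem exists_top_vector {B : V →ₗ[ℝ] V →ₗ[ℝ] ℝ} (hsymm : ∀ x y, B x y = B y x)
    {N : Module.End ℝ V} (hN : ∀ x y, B (N x) y = B x (N y)) (hnil : IsNilpotent N)
    {E : Submodule ℝ V} (hE0 : E ≠ ⊥) (hE : ∀ x ∈ E, N x ∈ E)
    (hnd : ∀ x ∈ E, (∀ y ∈ E, B x y = 0) → x = 0) :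
    ∃ q : ℕ, (∀ x ∈ E, (N ^ (q + 1)) x = 0) ∧ ∃ z ∈ E, B ((N ^ q) z) z ≠ 0 := by
  classical
  have hex : ∃ n, ∀ x ∈ E, (N ^ n) x = 0 := by
    obtain ⟨n, hn⟩ := hnil
    exact ⟨n, fun x _ => by simp [hn]⟩
  obtain ⟨q, hq⟩ : ∃ q, Nat.find hex = q + 1 := by
    refine Nat.exists_eq_succ_of_ne_zero fun h => hE0 ?_
    have := Nat.find_spec hex
    rw [h] at this
    exact (Submodule.eq_bot_iff _).2 fun x hx => by simpa using this x hx
  refine ⟨q, hq ▸ Nat.find_spec hex, ?_⟩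
  by_contra! h
  refine Nat.find_min hex (m := q) (by omega) fun x hx => ?_
  refine hnd _ (pow_mem_of_invariant hE q x hx) fun y hy => ?_
  have h1 := h _ (add_mem hx hy)
  have h2 : B ((N ^ q) y) x = B ((N ^ q) x) y := by rw [apply_pow_left hN, hsymm]
  simp only [map_add, LinearMap.add_apply, h x hx, h y hy, h2] at h1
  linarith

theorem exists_real_generator {B : V →ₗ[ℝ] V →ₗ[ℝ] ℝ}
    {N : Module.End ℝ V} (hN : ∀ x y, B (N x) y = B x (N y))
    {E : Submodule ℝ V} (hE : ∀ x ∈ E, N x ∈ E) {q : ℕ} (hq : ∀ x ∈ E, (N ^ (q + 1)) x = 0)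
    {ε : ℝ} (hε : ε ≠ 0) (hz : ∃ z ∈ E, B ((N ^ q) z) z = ε) :
    ∃ x ∈ E, ∀ k, B ((N ^ k) x) x = if k = q then ε else 0 := by
  suffices ∀ m ≤ q, ∃ x ∈ E, B ((N ^ q) x) x = ε ∧
      ∀ k, q - m ≤ k → k < q → B ((N ^ k) x) x = 0 by
    obtain ⟨x, hx, h1, h2⟩ := this q le_rfl
    refine ⟨x, hx, fun k => ?_⟩
    rcases lt_trichotomy k q with h | rfl | h
    · rw [if_neg h.ne, h2 k (by omega) h]
    · simp [h1]
    · rw [if_neg h.ne', pow_apply_eq_zero_of_lt (hq x hx) h]; simp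
  intro m
  induction m with
  | zero =>
    obtain ⟨z, hz, h⟩ := hz
    exact fun _ => ⟨z, hz, h, fun k h1 h2 => by omega⟩
  | succ m ih =>
    intro hm
    obtain ⟨x, hx, h1, h2⟩ := ih (by omega)
    set c : ℝ := -B ((N ^ (q - (m + 1))) x) x / (2 * ε) with hc
    have hbig : ∀ k, q < k → B ((N ^ k) x) x = 0 := fun k hk => by
      rw [pow_apply_eq_zero_of_lt (hq x hx) hk]; simp
    have key : ∀ k, B ((N ^ k) (x + c • (N ^ (m + 1)) x)) (x + c • (N ^ (m + 1)) x) =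
        B ((N ^ k) x) x + 2 * c * B ((N ^ (k + (m + 1))) x) x +
          c ^ 2 * B ((N ^ (k + (m + 1) + (m + 1))) x) x := by
      intro k
      have e1 : (N ^ k) ((N ^ (m + 1)) x) = (N ^ (k + (m + 1))) x := by
        rw [pow_add N k, Module.End.mul_apply]
      have e2 : ∀ y, B y ((N ^ (m + 1)) x) = B ((N ^ (m + 1)) y) x := fun y =>
        (apply_pow_left hN _ _ _).symm
      have e3 : ∀ l, (N ^ (m + 1)) ((N ^ l) x) = (N ^ (l + (m + 1))) x := fun l => by
        rw [add_comm l, pow_add N (m + 1), Module.End.mul_apply]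
      simp only [map_add, map_smul, LinearMap.add_apply, LinearMap.smul_apply, e1, e2, e3,
        smul_eq_mul]
      ring
    refine ⟨x + c • (N ^ (m + 1)) x,
      add_mem hx (E.smul_mem _ (pow_mem_of_invariant hE _ _ hx)), ?_, fun k hk1 hk2 => ?_⟩
    · rw [key, hbig (q + (m + 1)) (by omega), hbig (q + (m + 1) + (m + 1)) (by omega), h1]; ring
    · rw [key, hbig (k + (m + 1) + (m + 1)) (by omega)]
      rcases Nat.eq_or_lt_of_le hk1 with h | h
      · rw [← h, Nat.sub_add_cancel hm, h1, hc]
        field_simp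
        ring
      · rw [hbig (k + (m + 1)) (by omega), h2 k (by omega) hk2]; ring

theorem exists_complex_generator {B : V →ₗ[ℝ] V →ₗ[ℝ] ℝ}
    {N J : Module.End ℝ V} (hN : ∀ x y, B (N x) y = B x (N y))
    (hJ : ∀ x y, B (J x) y = B x (J y)) (hJN : Commute J N)
    {E : Submodule ℝ V} (hE : ∀ x ∈ E, N x ∈ E) (hEJ : ∀ x ∈ E, J x ∈ E)
    (hJJ : ∀ x ∈ E, J (J x) = -x) {q : ℕ} (hq : ∀ x ∈ E, (N ^ (q + 1)) x = 0)
    (hz : ∃ z ∈ E, B ((N ^ q) z) z ≠ 0) :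
    ∃ x ∈ E, (∀ k, B ((N ^ k) x) x = if k = q then 1 else 0) ∧
      ∀ k, B ((N ^ k) x) (J x) = 0 := by
  have hcomm : ∀ k y, (N ^ k) (J y) = J ((N ^ k) y) := fun k y =>
    (LinearMap.congr_fun (hJN.pow_right k).eq y).symm
  -- The values of the form on a translate of `x` by a multiple of `N ^ l x`.
  have key : ∀ x ∈ E, ∀ (s c d : ℝ) (l k : ℕ),
      B ((N ^ k) (s • x + (c • (N ^ l) x + d • J ((N ^ l) x))))
          (s • x + (c • (N ^ l) x + d • J ((N ^ l) x))) =
        s ^ 2 * B ((N ^ k) x) x + 2 * s * (c * B ((N ^ (k + l)) x) x +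
          d * B ((N ^ (k + l)) x) (J x)) + ((c ^ 2 - d ^ 2) * B ((N ^ (k + l + l)) x) x +
          2 * c * d * B ((N ^ (k + l + l)) x) (J x)) ∧
      B ((N ^ k) (s • x + (c • (N ^ l) x + d • J ((N ^ l) x))))
          (J (s • x + (c • (N ^ l) x + d • J ((N ^ l) x)))) =
        s ^ 2 * B ((N ^ k) x) (J x) + 2 * s * (c * B ((N ^ (k + l)) x) (J x) -
          d * B ((N ^ (k + l)) x) x) + ((c ^ 2 - d ^ 2) * B ((N ^ (k + l + l)) x) (J x) -
          2 * c * d * B ((N ^ (k + l + l)) x) x) := by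
    intro x hx s c d l k
    have e1 : (N ^ k) ((N ^ l) x) = (N ^ (k + l)) x := by
      rw [pow_add N k, Module.End.mul_apply]
    have e2 : ∀ y z, B y ((N ^ l) z) = B ((N ^ l) y) z := fun y z =>
      (apply_pow_left hN _ _ _).symm
    have e3 : ∀ n, (N ^ l) ((N ^ n) x) = (N ^ (n + l)) x := fun n => by
      rw [add_comm, pow_add, Module.End.mul_apply]
    have e4 : J (J ((N ^ l) x)) = -(N ^ l) x := hJJ _ (pow_mem_of_invariant hE _ _ hx)
    have e5 : ∀ n y, B (J ((N ^ n) x)) y = B ((N ^ n) x) (J y) := fun n y => hJ _ _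
    have e6 : ∀ y, B y (J ((N ^ l) x)) = B ((N ^ l) y) (J x) := fun y => by
      rw [← hcomm, e2]
    constructor <;>
    · simp only [map_add, map_smul, map_neg, LinearMap.add_apply, LinearMap.smul_apply,
        hcomm, e5, e4, e1, e6, e2, e3, hJJ x hx, smul_eq_mul]
      ring
  have hmem : ∀ x ∈ E, ∀ (s c d : ℝ) (l : ℕ),
      s • x + (c • (N ^ l) x + d • J ((N ^ l) x)) ∈ E := fun x hx s c d l =>
    have := pow_mem_of_invariant hE l x hx
    add_mem (E.smul_mem _ hx) (add_mem (E.smul_mem _ this) (E.smul_mem _ (hEJ _ this)))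
  suffices ∀ m ≤ q, ∃ x ∈ E, B ((N ^ q) x) x = 1 ∧ B ((N ^ q) x) (J x) = 0 ∧
      ∀ k, q - m ≤ k → k < q → B ((N ^ k) x) x = 0 ∧ B ((N ^ k) x) (J x) = 0 by
    obtain ⟨x, hx, h1, h2, h3⟩ := this q le_rfl
    refine ⟨x, hx, fun k => ?_, fun k => ?_⟩ <;> rcases lt_trichotomy k q with h | rfl | h
    · rw [if_neg h.ne, (h3 k (by omega) h).1]
    · simp [h1]
    · rw [if_neg h.ne', pow_apply_eq_zero_of_lt (hq x hx) h]; simp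
    · exact (h3 k (by omega) h).2
    · exact h2
    · rw [pow_apply_eq_zero_of_lt (hq x hx) h]; simp
  intro m
  induction m with
  | zero =>
    obtain ⟨z, hz, h⟩ := hz
    set α := B ((N ^ q) z) z with hα
    set β := B ((N ^ q) z) (J z) with hβ
    have hne : (⟨α, -β⟩ : ℂ) ≠ 0 := fun h' => h (congrArg Complex.re h')
    obtain ⟨w, hw⟩ := IsAlgClosed.exists_pow_nat_eq ((⟨α, -β⟩ : ℂ)⁻¹) (n := 2) (by norm_num)
    have hw' : w ^ 2 * (⟨α, -β⟩ : ℂ) = 1 := by rw [hw, inv_mul_cancel₀ hne]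
    have hre := congrArg Complex.re hw'
    have him := congrArg Complex.im hw'
    simp [pow_two] at hre him
    refine fun _ => ⟨_, hmem z hz 0 w.re w.im 0, ?_, ?_, fun k h1 h2 => by omega⟩
    · rw [(key z hz 0 w.re w.im 0 q).1]
      simp only [add_zero, ← hα, ← hβ]
      linarith
    · rw [(key z hz 0 w.re w.im 0 q).2]
      simp only [add_zero, ← hα, ← hβ]
      linarith
  | succ m ih =>
    intro hm
    obtain ⟨x, hx, h1, h2, h3⟩ := ih (by omega)
    have hbig : ∀ k, q < k → ∀ y, B ((N ^ k) x) y = 0 := fun k hk y => by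
      rw [pow_apply_eq_zero_of_lt (hq x hx) hk]; simp
    have hbig1 := hbig (q + (m + 1)) (by omega)
    have hbig2 := hbig (q + (m + 1) + (m + 1)) (by omega)
    set c : ℝ := -B ((N ^ (q - (m + 1))) x) x / 2 with hc
    set d : ℝ := B ((N ^ (q - (m + 1))) x) (J x) / 2 with hd
    have key' := key x hx 1 c d (m + 1)
    refine ⟨_, hmem x hx 1 c d (m + 1), ?_, ?_, fun k hk1 hk2 => ?_⟩
    · rw [(key' q).1, hbig1, hbig1, hbig2, hbig2, h1]
      ring
    · rw [(key' q).2, hbig1, hbig1, hbig2, hbig2, h2]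
      ring
    · rw [(key' k).1, (key' k).2, hbig (k + (m + 1) + (m + 1)) (by omega),
        hbig (k + (m + 1) + (m + 1)) (by omega)]
      rcases Nat.eq_or_lt_of_le hk1 with h | h
      · rw [← h, Nat.sub_add_cancel hm, h1, h2, hc, hd]
        constructor <;> ring
      · rw [hbig (k + (m + 1)) (by omega), hbig (k + (m + 1)) (by omega), (h3 k (by omega) hk2).1,
          (h3 k (by omega) hk2).2]
        constructor <;> ring

open Polynomial in
theorem aeval_selfAdjoint {B : V →ₗ[ℝ] V →ₗ[ℝ] ℝ} {T : Module.End ℝ V}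
    (hT : ∀ x y, B (T x) y = B x (T y)) (f : ℝ[X]) :
    ∀ x y, B (aeval T f x) y = B x (aeval T f y) := by
  induction f using Polynomial.induction_on' with
  | add f g hf hg => intro x y; simp [hf, hg]
  | monomial n a => intro x y; simp [aeval_monomial, Module.algebraMap_end_apply,
      apply_pow_left hT]

open Polynomial in
/-- The kernel of a nontrivial factor of the minimal polynomial of a semisimple self-adjoint
operator is nonzero and nondegenerate. -/
theorem ker_aeval_nondegenerate [FiniteDimensional ℝ V] {B : V →ₗ[ℝ] V →ₗ[ℝ] ℝ}
    (hnondeg : ∀ x, (∀ y, B x y = 0) → x = 0) {D : Module.End ℝ V}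
    (hD : ∀ x y, B (D x) y = B x (D y)) (hss : D.IsSemisimple) {g : ℝ[X]}
    (hg : g ∣ minpoly ℝ D) (hu : ¬ IsUnit g) :
    LinearMap.ker (aeval D g) ≠ ⊥ ∧ ∀ x ∈ LinearMap.ker (aeval D g),
      (∀ y ∈ LinearMap.ker (aeval D g), B x y = 0) → x = 0 := by
  obtain ⟨r, hr⟩ := hg
  have hsq : Squarefree (g * r) := hr ▸ hss.minpoly_squarefree
  have h0 : aeval D (g * r) = 0 := hr ▸ minpoly.aeval ℝ D
  have hne : minpoly ℝ D ≠ 0 := minpoly.ne_zero (Algebra.IsIntegral.isIntegral D)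
  constructor
  · intro hker
    have hr0 : aeval D r = 0 := by
      ext x
      have := LinearMap.congr_fun h0 x
      rw [map_mul, Module.End.mul_apply] at this
      simpa using (LinearMap.ker_eq_bot'.1 hker) _ this
    obtain ⟨s, hs⟩ := minpoly.dvd ℝ D hr0
    have hrne : r ≠ 0 := fun h => hne (by rw [hr, h, mul_zero])
    apply hu
    refine IsUnit.of_mul_eq_one s (mul_right_cancel₀ hrne ?_)
    rw [one_mul]
    conv_rhs => rw [hs, hr]
    ring
  · intro x hx hxy
    obtain ⟨s, t, hst⟩ := (IsRelPrime.of_squarefree_mul hsq).isCoprime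
    refine hnondeg x fun y => ?_
    have hy : y = aeval D g (aeval D s y) + aeval D (t * r) y := by
      rw [← Module.End.mul_apply, ← map_mul, ← LinearMap.add_apply, ← map_add, mul_comm g, hst]
      simp
    rw [hy, map_add, ← aeval_selfAdjoint hD, LinearMap.mem_ker.1 hx, hxy, map_zero,
      LinearMap.zero_apply, add_zero]
    rw [LinearMap.mem_ker, ← Module.End.mul_apply, ← map_mul,
      show g * (t * r) = t * (g * r) by ring, map_mul, h0, mul_zero, LinearMap.zero_apply]

theorem IsRealBlock.ne_bot {B : V →ₗ[ℝ] V →ₗ[ℝ] ℝ} {T : Module.End ℝ V} {lam : ℝ} {p : ℕ}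
    {ε : ℝ} {W : Submodule ℝ V} (h : IsRealBlock B T lam p ε W) : W ≠ ⊥ := by
  obtain ⟨hp, -, v, -, -, -, hli, rfl⟩ := h
  intro hbot
  have : v 1 ∈ Submodule.span ℝ (v '' Set.Icc 1 p) :=
    Submodule.subset_span ⟨1, ⟨le_rfl, hp⟩, rfl⟩
  rw [hbot, Submodule.mem_bot] at this
  exact hli.ne_zero ⟨0, hp⟩ (by simpa using this)

theorem IsComplexBlock.ne_bot {B : V →ₗ[ℝ] V →ₗ[ℝ] ℝ} {T : Module.End ℝ V} {a b : ℝ}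
    {p : ℕ} {W : Submodule ℝ V} (h : IsComplexBlock B T a b p W) : W ≠ ⊥ := by
  obtain ⟨hp, -, u, v, -, -, -, -, -, -, -, hli, rfl⟩ := h
  intro hbot
  have : u 1 ∈ Submodule.span ℝ (u '' Set.Icc 1 p ∪ v '' Set.Icc 1 p) :=
    Submodule.subset_span (Or.inl ⟨1, ⟨le_rfl, hp⟩, rfl⟩)
  rw [hbot, Submodule.mem_bot] at this
  exact hli.ne_zero (Sum.inl ⟨0, hp⟩) (by simpa using this)

theorem exists_realBlock_of_eigen {B : V →ₗ[ℝ] V →ₗ[ℝ] ℝ} {T N : Module.End ℝ V} {lam : ℝ}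
    (hN : ∀ x y, B (N x) y = B x (N y)) {E : Submodule ℝ V} (hE : ∀ x ∈ E, N x ∈ E)
    (hT : ∀ x ∈ E, T x = lam • x + N x) {q : ℕ} (hq : ∀ x ∈ E, (N ^ (q + 1)) x = 0)
    (hz : ∃ z ∈ E, B ((N ^ q) z) z ≠ 0) :
    ∃ p ε W, IsRealBlock B T lam p ε W := by
  obtain ⟨ε, hε, z, hzE, hz⟩ : ∃ ε : ℝ, (ε = 1 ∨ ε = -1) ∧ ∃ z ∈ E, B ((N ^ q) z) z = ε := by
    obtain ⟨z, hzE, hz⟩ := hz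
    set α := B ((N ^ q) z) z with hα
    refine ⟨α / |α|, ?_, (√|α|)⁻¹ • z, E.smul_mem _ hzE, ?_⟩
    · rcases lt_or_gt_of_ne hz with h | h
      · right; rw [abs_of_neg h]; field_simp
      · left; rw [abs_of_pos h]; field_simp
    · have hs : √|α| * √|α| = |α| := Real.mul_self_sqrt (abs_nonneg _)
      simp only [map_smul, LinearMap.smul_apply, smul_eq_mul, ← hα]
      rw [← mul_assoc, ← mul_inv, hs, div_eq_inv_mul]
  obtain ⟨x, hxE, hx⟩ := exists_real_generator hN hE hq (sign_ne_zero_of_eq hε) ⟨z, hzE, hz⟩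
  refine ⟨q + 1, ε, _, IsRealBlock.of_chain (v := fun j => (N ^ (j - 1)) x) (by omega) hε
    (by simpa using hq x hxE) (fun j h1 h2 => ?_) (fun i j h1 h2 h3 h4 => ?_)⟩
  · obtain ⟨j, rfl⟩ := Nat.exists_eq_add_of_le' h1
    simp only [Nat.add_sub_cancel]
    rw [hT _ (pow_mem_of_invariant hE _ _ hxE), pow_succ', Module.End.mul_apply]
  · rw [← apply_pow_left hN, ← Module.End.mul_apply, ← pow_add, hx]
    congr 1
    rw [eq_iff_iff]
    omega

theorem exists_complexBlock_of_eigen {B : V →ₗ[ℝ] V →ₗ[ℝ] ℝ} (hsymm : ∀ x y, B x y = B y x)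
    {T N J : Module.End ℝ V} {a b : ℝ} (hb : 0 < b)
    (hN : ∀ x y, B (N x) y = B x (N y)) (hJ : ∀ x y, B (J x) y = B x (J y))
    (hJN : Commute J N) {E : Submodule ℝ V} (hE : ∀ x ∈ E, N x ∈ E) (hEJ : ∀ x ∈ E, J x ∈ E)
    (hJJ : ∀ x ∈ E, J (J x) = -x) (hT : ∀ x ∈ E, T x = a • x + b • J x + N x)
    {q : ℕ} (hq : ∀ x ∈ E, (N ^ (q + 1)) x = 0) (hz : ∃ z ∈ E, B ((N ^ q) z) z ≠ 0) :
    ∃ p W, IsComplexBlock B T a b p W := by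
  obtain ⟨x, hxE, hx1, hx2⟩ := exists_complex_generator hN hJ hJN hE hEJ hJJ hq hz
  have hmem := fun k => pow_mem_of_invariant hE k x hxE
  have hcomm : ∀ y, N (J y) = J (N y) := fun y => (LinearMap.congr_fun hJN.eq y).symm
  have hgram : ∀ i j y, B ((N ^ i) x) ((N ^ j) y) = B ((N ^ (j + i)) x) y := fun i j y => by
    rw [← apply_pow_left hN, ← Module.End.mul_apply, ← pow_add]
  have hcommk : ∀ k y, (N ^ k) (J y) = J ((N ^ k) y) := fun k y =>
    (LinearMap.congr_fun (hJN.pow_right k).eq y).symm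
  refine ⟨q + 1, _, IsComplexBlock.of_chain (u := fun j => (N ^ (j - 1)) x)
    (v := fun j => -J ((N ^ (j - 1)) x)) hsymm (by omega) hb
    (by simpa using hq x hxE) (by simpa using by rw [hq x hxE, map_zero])
    (fun j h1 h2 => ?_) (fun j h1 h2 => ?_) (fun i j h1 h2 h3 h4 => ?_)
    (fun i j h1 h2 h3 h4 => ?_) (fun i j h1 h2 h3 h4 => ?_)⟩
  · obtain ⟨j, rfl⟩ := Nat.exists_eq_add_of_le' h1
    simp only [Nat.add_sub_cancel]
    rw [hT _ (hmem j), pow_succ', Module.End.mul_apply]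
    module
  · obtain ⟨j, rfl⟩ := Nat.exists_eq_add_of_le' h1
    simp only [Nat.add_sub_cancel]
    rw [map_neg, hT _ (hEJ _ (hmem j)), hJJ _ (hmem j), pow_succ', Module.End.mul_apply, hcomm]
    module
  · rw [hgram, hx1]
    congr 1
    rw [eq_iff_iff]
    omega
  · simp only [map_neg, LinearMap.neg_apply, neg_neg]
    rw [hJ, hJJ _ (hmem _), map_neg, hgram, hx1, neg_eq_iff_eq_neg]
    split_ifs <;> first | omega | simp
  · simp only [map_neg]
    rw [← hcommk, hgram, hx2, neg_zero]

open Polynomial in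
/-- A self-adjoint operator on a nonzero scalar product space has a metric-Jordan block. -/
theorem exists_block [FiniteDimensional ℝ V] [Nontrivial V] {B : V →ₗ[ℝ] V →ₗ[ℝ] ℝ}
    (hsymm : ∀ x y, B x y = B y x) (hnondeg : ∀ x, (∀ y, B x y = 0) → x = 0)
    {T : Module.End ℝ V} (hT : ∀ x y, B (T x) y = B x (T y)) :
    ∃ W, (∃ lam p ε, IsRealBlock B T lam p ε W) ∨ (∃ a b p, IsComplexBlock B T a b p W) := by
  obtain ⟨N, hN, D, hD, hnil, hss, hsum⟩ := T.exists_isNilpotent_isSemisimple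
  rw [Algebra.adjoin_singleton_eq_range_aeval] at hN hD
  obtain ⟨h, rfl⟩ := hN
  obtain ⟨f, rfl⟩ := hD
  simp only [AlgHom.toRingHom_eq_coe, RingHom.coe_coe] at hnil hss hsum
  set N := aeval T h with hNdef
  set D := aeval T f with hDdef
  have hNsa : ∀ x y, B (N x) y = B x (N y) := aeval_selfAdjoint hT h
  have hDsa : ∀ x y, B (D x) y = B x (D y) := aeval_selfAdjoint hT f
  have hcomm : Commute N D := by
    rw [Commute, SemiconjBy, hNdef, hDdef, ← map_mul, mul_comm, map_mul]
  have hcommg : ∀ g : ℝ[X], Commute N (aeval D g) := fun g => by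
    rw [Commute, SemiconjBy, hNdef, hDdef, ← aeval_comp, ← map_mul, mul_comm, map_mul]
  have hEN : ∀ g : ℝ[X], ∀ x ∈ LinearMap.ker (aeval D g), N x ∈ LinearMap.ker (aeval D g) := by
    intro g x hx
    rw [LinearMap.mem_ker] at hx ⊢
    rw [← Module.End.mul_apply, ← (hcommg g).eq, Module.End.mul_apply, hx, map_zero]
  have hTx : ∀ x, T x = D x + N x := fun x => by
    conv_lhs => rw [hsum]
    rw [LinearMap.add_apply, add_comm]
  have hintegral : IsIntegral ℝ D := Algebra.IsIntegral.isIntegral D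
  obtain ⟨z, hz⟩ := IsAlgClosed.exists_aeval_eq_zero ℂ (minpoly ℝ D) (minpoly.degree_pos hintegral).ne'
  by_cases him : z.im = 0
  · have hzr : z = algebraMap ℝ ℂ z.re := Complex.ext (by simp) (by simp [him])
    have hdvd : X - C z.re ∣ minpoly ℝ D := by
      rw [dvd_iff_isRoot, IsRoot.def, ← coe_aeval_eq_eval]
      rw [hzr] at hz
      exact (aeval_algebraMap_eq_zero_iff ℂ z.re _).1 hz
    obtain ⟨hE0, hEnd⟩ := ker_aeval_nondegenerate hnondeg hDsa hss hdvd (not_isUnit_X_sub_C _)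
    obtain ⟨q, hq, hqz⟩ := exists_top_vector hsymm hNsa hnil hE0 (hEN _) hEnd
    obtain ⟨p, ε, W, hW⟩ := exists_realBlock_of_eigen (T := T) (lam := z.re) hNsa (hEN _)
      (fun x hx => by
        rw [LinearMap.mem_ker] at hx
        have : D x = z.re • x := by simpa [sub_eq_zero] using hx
        rw [hTx, this]) hq hqz
    exact ⟨W, Or.inl ⟨_, _, _, hW⟩⟩
  · have hdvd := (minpoly ℝ D).quadratic_dvd_of_aeval_eq_zero_im_ne_zero hz him
    set g : ℝ[X] := X ^ 2 - C (2 * z.re) * X + C (‖z‖ ^ 2) with hg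
    have hgd : g.natDegree = 2 := by rw [hg]; compute_degree!
    obtain ⟨hE0, hEnd⟩ := ker_aeval_nondegenerate hnondeg hDsa hss hdvd
      (not_isUnit_of_natDegree_pos _ (by omega))
    obtain ⟨q, hq, hqz⟩ := exists_top_vector hsymm hNsa hnil hE0 (hEN _) hEnd
    have hb : 0 < |z.im| := abs_pos.2 him
    have hbb : |z.im| ^ 2 = ‖z‖ ^ 2 - z.re ^ 2 := by
      rw [sq_abs, ← Complex.normSq_eq_norm_sq, Complex.normSq_apply]; ring
    set b := |z.im| with hbdef
    set J : Module.End ℝ V := b⁻¹ • (D - z.re • 1) with hJ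
    have hJx : ∀ x, J x = b⁻¹ • (D x - z.re • x) := fun x => by simp [hJ]
    have hEJ : ∀ x ∈ LinearMap.ker (aeval D g), J x ∈ LinearMap.ker (aeval D g) := by
      intro x hx
      rw [hJx]
      refine Submodule.smul_mem _ _ (Submodule.sub_mem _ ?_ (Submodule.smul_mem _ _ hx))
      rw [LinearMap.mem_ker] at hx ⊢
      have : aeval D g * D = D * aeval D g := by
        simpa only [map_mul, aeval_X] using congrArg (aeval D) (mul_comm g X)
      rw [← Module.End.mul_apply, this, Module.End.mul_apply, hx, map_zero]
    obtain ⟨p, W, hW⟩ := exists_complexBlock_of_eigen (T := T) (J := J) (a := z.re) hsymm hb hNsa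
      (fun x y => by simp [hJx, hDsa])
      (by
        rw [hJ]
        exact ((hcomm.symm.sub_left ((Commute.one_left N).smul_left _)).smul_left _))
      (hEN _) hEJ
      (fun x hx => by
        have h0 : D (D x) - (2 * z.re) • D x + ‖z‖ ^ 2 • x = 0 := by
          rw [← LinearMap.mem_ker.1 hx]
          simp only [hg, map_add, map_sub, map_mul, pow_two (X : ℝ[X]), aeval_X, aeval_C,
            LinearMap.add_apply, LinearMap.sub_apply, Module.End.mul_apply,
            Module.algebraMap_end_apply]
          module
        have h1 : D (D x) = (2 * z.re) • D x - ‖z‖ ^ 2 • x := by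
          rw [← sub_eq_zero, ← h0]; abel
        rw [hJx, hJx, map_smul, map_sub, map_smul, h1]
        have h2 : -x = -(b⁻¹ * b⁻¹ * b ^ 2) • x := by
          rw [show b⁻¹ * b⁻¹ * b ^ 2 = 1 by field_simp]; simp
        rw [h2, hbb]
        module)
      (fun x _ => by
        rw [hTx, hJx, smul_smul, mul_inv_cancel₀ hb.ne']
        module) hq hqz
    exact ⟨W, Or.inr ⟨_, _, _, hW⟩⟩

theorem iSupIndep_of_orthogonal {ι : Type*} {B : V →ₗ[ℝ] V →ₗ[ℝ] ℝ}
    (hsymm : ∀ x y, B x y = B y x) (hnondeg : ∀ x, (∀ y, B x y = 0) → x = 0)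
    {W : ι → Submodule ℝ V} (htop : ⨆ i, W i = ⊤)
    (horth : ∀ i j, i ≠ j → ∀ x ∈ W i, ∀ y ∈ W j, B x y = 0) : iSupIndep W := by
  intro i
  rw [Submodule.disjoint_def]
  intro x hx hx'
  have hle : ∀ (z : V) (s : Submodule ℝ V), (∀ y ∈ s, B z y = 0) ↔ s ≤ LinearMap.ker (B z) :=
    fun z s => Iff.rfl
  have h1 : ∀ j ≠ i, ∀ y ∈ W i, ∀ z ∈ W j, B y z = 0 := fun j hj => horth i j hj.symm
  have h2 : ∀ y ∈ W i, B y x = 0 := fun y hy =>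
    (iSup₂_le (fun j hj => (hle y (W j)).1 (h1 j hj y hy)) : _ ≤ LinearMap.ker (B y)) hx'
  refine hnondeg x fun y => ?_
  have : (⊤ : Submodule ℝ V) ≤ LinearMap.ker (B x) := by
    rw [← htop]
    refine iSup_le fun j => (hle x (W j)).1 ?_
    by_cases hj : j = i
    · subst hj
      exact fun y hy => by rw [hsymm, h2 y hy]
    · exact h1 j hj x hx
  exact this (Submodule.mem_top (x := y))

/-- A self-adjoint operator on a scalar product space has a metric-Jordan decomposition. -/
theorem exists_metricJordanDecomposition.{u} (n : ℕ) :
    ∀ (V : Type u) [AddCommGroup V] [Module ℝ V] [FiniteDimensional ℝ V],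
    Module.finrank ℝ V = n → ∀ (B : V →ₗ[ℝ] V →ₗ[ℝ] ℝ), (∀ x y, B x y = B y x) →
    (∀ x, (∀ y, B x y = 0) → x = 0) → ∀ T : Module.End ℝ V,
    (∀ x y, B (T x) y = B x (T y)) →
    ∃ (k : ℕ) (W : Fin k → Submodule ℝ V), IsMetricJordanDecomposition B T W := by
  induction n using Nat.strong_induction_on with
  | h n ih =>
  intro V _ _ _ hn B hsymm hnondeg T hT
  rcases subsingleton_or_nontrivial V with hV | hV
  · exact ⟨0, Fin.elim0, Subsingleton.elim _ _, fun i => i.elim0, fun i => i.elim0,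
      fun i => i.elim0, fun i => i.elim0⟩
  obtain ⟨U, hU⟩ := exists_block hsymm hnondeg hT
  have hUbot : U ≠ ⊥ := by
    rcases hU with ⟨_, _, _, h⟩ | ⟨_, _, _, h⟩
    exacts [h.ne_bot, h.ne_bot]
  have hUinv : ∀ x ∈ U, T x ∈ U := by
    rcases hU with ⟨_, _, _, h⟩ | ⟨_, _, _, h⟩
    exacts [h.invariant, h.invariant]
  have hUnd : ∀ x ∈ U, (∀ y ∈ U, B x y = 0) → x = 0 := by
    rcases hU with ⟨_, _, _, h⟩ | ⟨_, _, _, h⟩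
    exacts [h.nondegenerate, h.nondegenerate hsymm]
  set O : Submodule ℝ V := LinearMap.BilinForm.orthogonal B U with hO
  have hmemO : ∀ x, x ∈ O ↔ ∀ y ∈ U, B y x = 0 := fun x => Iff.rfl
  have hcompl : IsCompl U O := by
    refine LinearMap.BilinForm.isCompl_orthogonal_of_restrict_nondegenerate
      (fun x y h => by rw [hsymm, h]) ⟨fun x hx => ?_, fun x hx => ?_⟩
    · exact Subtype.ext (hUnd x x.2 fun y hy => hx ⟨y, hy⟩)
    · exact Subtype.ext (hUnd x x.2 fun y hy => by rw [hsymm]; exact hx ⟨y, hy⟩)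
  have hOinv : ∀ x ∈ O, T x ∈ O := fun x hx => (hmemO _).2 fun y hy => by
    rw [← hT]; exact (hmemO x).1 hx _ (hUinv y hy)
  have hlt : Module.finrank ℝ O < n := by
    have h1 := Submodule.finrank_add_eq_of_isCompl hcompl
    have h2 : 0 < Module.finrank ℝ U := by
      rwa [Nat.pos_iff_ne_zero, Ne, Submodule.finrank_eq_zero]
    omega
  obtain ⟨k, W, htop, -, horth, hinv, hblock⟩ := ih _ hlt O rfl (B.domRestrict₁₂ O O)
    (fun x y => hsymm _ _)
    (fun x hx => Subtype.ext <| hnondeg x fun y => by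
      obtain ⟨u, hu, v, hv, rfl⟩ := Submodule.mem_sup.1
        (hcompl.sup_eq_top ▸ Submodule.mem_top : y ∈ U ⊔ O)
      rw [map_add, hsymm, (hmemO x).1 x.2 u hu, zero_add]
      exact hx ⟨v, hv⟩)
    (T.restrict hOinv) (fun x y => hT _ _)
  have hWO : ∀ i, (W i).map O.subtype ≤ O := fun i => Submodule.map_subtype_le _ _
  have htop' : (⨆ i, (Fin.cons U fun i => (W i).map O.subtype : Fin (k + 1) → Submodule ℝ V) i)
      = ⊤ := by
    have : (⨆ i, (Fin.cons U fun i => (W i).map O.subtype : Fin (k + 1) → Submodule ℝ V) i)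
        = U ⊔ ⨆ i, (W i).map O.subtype := by
      apply le_antisymm
      · refine iSup_le (Fin.cases ?_ fun i => ?_)
        · simp
        · rw [Fin.cons_succ]
          exact le_sup_of_le_right (le_iSup (fun i => (W i).map O.subtype) i)
      · refine sup_le ?_ (iSup_le fun i => ?_)
        · exact le_iSup_of_le 0 (by simp)
        · exact le_iSup_of_le i.succ (by simp)
    rw [this, ← Submodule.map_iSup, htop, Submodule.map_subtype_top, hcompl.sup_eq_top]
  have horth' : ∀ i j, i ≠ j →
      ∀ x ∈ (Fin.cons U fun i => (W i).map O.subtype : Fin (k + 1) → Submodule ℝ V) i,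
      ∀ y ∈ (Fin.cons U fun i => (W i).map O.subtype : Fin (k + 1) → Submodule ℝ V) j,
      B x y = 0 := by
    intro i j hij x hx y hy
    induction i using Fin.cases with
    | zero =>
      induction j using Fin.cases with
      | zero => exact absurd rfl hij
      | succ j => exact (hmemO y).1 (hWO j hy) x hx
    | succ i =>
      induction j using Fin.cases with
      | zero => rw [hsymm]; exact (hmemO x).1 (hWO i hx) y hy
      | succ j =>
        obtain ⟨x, hx, rfl⟩ := hx
        obtain ⟨y, hy, rfl⟩ := hy
        exact horth i j (fun h => hij (by rw [h])) x hx y hy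
  refine ⟨k + 1, _, htop', iSupIndep_of_orthogonal hsymm hnondeg htop' horth', horth', ?_, ?_⟩
  · intro i
    induction i using Fin.cases with
    | zero => exact hUinv
    | succ i =>
      rintro _ ⟨x, hx, rfl⟩
      exact ⟨_, hinv i x hx, rfl⟩
  · intro i
    induction i using Fin.cases with
    | zero => exact hU
    | succ i =>
      rcases hblock i with ⟨lam, p, ε, h⟩ | ⟨a, b, p, h⟩
      · exact Or.inl ⟨lam, p, ε, h.map O.subtype (fun x _ y _ => rfl) fun x _ => rfl⟩
      · exact Or.inr ⟨a, b, p, h.map hsymm O.subtype (fun x _ y _ => rfl) fun x _ => rfl⟩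

/-- `HasBlockData B T d W` says that `W` is a block with data `d`, the left summand holding the
data of real blocks and the right summand the data of complex blocks. -/
def HasBlockData (B : V →ₗ[ℝ] V →ₗ[ℝ] ℝ) (T : Module.End ℝ V) :
    (ℝ × ℕ × ℝ) ⊕ (ℝ × ℝ × ℕ) → Submodule ℝ V → Prop
  | Sum.inl d => IsRealBlock B T d.1 d.2.1 d.2.2
  | Sum.inr d => IsComplexBlock B T d.1 d.2.1 d.2.2

theorem HasBlockData.map {B : V →ₗ[ℝ] V →ₗ[ℝ] ℝ} (hsymm : ∀ x y, B x y = B y x)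
    {S T : Module.End ℝ V} {d : (ℝ × ℕ × ℝ) ⊕ (ℝ × ℝ × ℕ)} {W : Submodule ℝ V}
    (h : HasBlockData B S d W) (f : V →ₗ[ℝ] V)
    (hB : ∀ x ∈ W, ∀ y ∈ W, B (f x) (f y) = B x y) (hT : ∀ x ∈ W, T (f x) = f (S x)) :
    HasBlockData B T d (W.map f) := by
  rcases d with d | d
  · exact IsRealBlock.map h f hB hT
  · exact IsComplexBlock.map hsymm h f hB hT

theorem HasBlockData.exists_map_eq {B : V →ₗ[ℝ] V →ₗ[ℝ] ℝ} (hsymm : ∀ x y, B x y = B y x)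
    {S T : Module.End ℝ V} {d : (ℝ × ℕ × ℝ) ⊕ (ℝ × ℝ × ℕ)} {W W' : Submodule ℝ V}
    (h : HasBlockData B S d W) (h' : HasBlockData B T d W') :
    ∃ f : V →ₗ[ℝ] V, W.map f = W' ∧ (∀ x ∈ W, ∀ y ∈ W, B (f x) (f y) = B x y) ∧
      ∀ x ∈ W, T (f x) = f (S x) := by
  rcases d with d | d
  · exact IsRealBlock.exists_map_eq h h'
  · exact IsComplexBlock.exists_map_eq hsymm hsymm h h'

theorem HasBlockData.imp {B : V →ₗ[ℝ] V →ₗ[ℝ] ℝ} (hsymm : ∀ x y, B x y = B y x)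
    {S T : Module.End ℝ V} {d d' : (ℝ × ℕ × ℝ) ⊕ (ℝ × ℝ × ℕ)} {W W' : Submodule ℝ V}
    (h : HasBlockData B S d W) (h' : HasBlockData B T d W') (hd : HasBlockData B S d' W) :
    HasBlockData B T d' W' := by
  obtain ⟨f, rfl, hB, hT⟩ := h.exists_map_eq hsymm h'
  exact hd.map hsymm f hB hT

/-- Two finite families of sets that are pairwise equal or disjoint and cover each element equally
often agree up to a permutation. -/
theorem exists_equiv_of_card_mem_eq {ι κ α : Type*} [Finite ι] [Finite κ]
    (P : ι → Set α) (Q : κ → Set α)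
    (hP : ∀ i, (P i).Nonempty) (hQ : ∀ j, (Q j).Nonempty)
    (hPP : ∀ d i i', d ∈ P i → d ∈ P i' → P i = P i')
    (hQQ : ∀ d j j', d ∈ Q j → d ∈ Q j' → Q j = Q j')
    (hPQ : ∀ d i j, d ∈ P i → d ∈ Q j → P i = Q j)
    (hcard : ∀ d, Nat.card {i // d ∈ P i} = Nat.card {j // d ∈ Q j}) :
    ∃ σ : ι ≃ κ, ∀ i, Q (σ i) = P i := by
  have hfib : ∀ s d, d ∈ s → ((∃ i, P i = s) ∨ ∃ j, Q j = s) →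
      Nat.card {i // P i = s} = Nat.card {j // Q j = s} := by
    intro s d hd h
    have h1 : ∀ i, P i = s ↔ d ∈ P i := fun i => ⟨fun hi => hi ▸ hd, fun hi => by
      rcases h with ⟨i', rfl⟩ | ⟨j, rfl⟩
      exacts [hPP d _ _ hi hd, hPQ d _ _ hi hd]⟩
    have h2 : ∀ j, Q j = s ↔ d ∈ Q j := fun j => ⟨fun hj => hj ▸ hd, fun hj => by
      rcases h with ⟨i, rfl⟩ | ⟨j', rfl⟩
      exacts [(hPQ d _ _ hd hj).symm, hQQ d _ _ hj hd]⟩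
    simp only [h1, h2, hcard]
  have key : ∀ s, Nonempty ({i // P i = s} ≃ {j // Q j = s}) := by
    intro s
    by_cases h : (∃ i, P i = s) ∨ ∃ j, Q j = s
    · obtain ⟨d, hd⟩ : s.Nonempty := by
        rcases h with ⟨i, rfl⟩ | ⟨j, rfl⟩
        exacts [hP i, hQ j]
      exact Finite.card_eq.1 (hfib s d hd h)
    · push Not at h
      have := Subtype.isEmpty_of_false h.1
      have := Subtype.isEmpty_of_false h.2
      exact ⟨Equiv.equivOfIsEmpty _ _⟩
  exact ⟨Equiv.ofFiberEquiv fun s => (key s).some, Equiv.ofFiberEquiv_map _⟩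

theorem exists_linearMap_eq_on_components {ι : Type*} [DecidableEq ι] {W : ι → Submodule ℝ V}
    (htop : ⨆ i, W i = ⊤) (hind : iSupIndep W) (f : ι → V →ₗ[ℝ] V) :
    ∃ R : V →ₗ[ℝ] V, ∀ i, ∀ x ∈ W i, R x = f i x := by
  have hinternal := DirectSum.isInternal_submodule_of_iSupIndep_of_iSup_eq_top hind htop
  let e := LinearEquiv.ofBijective (DirectSum.coeLinearMap W) hinternal
  refine ⟨DirectSum.toModule ℝ ι V (fun i => f i ∘ₗ (W i).subtype) ∘ₗ e.symm.toLinearMap,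
    fun i x hx => ?_⟩
  have : e.symm x = DirectSum.lof ℝ ι (fun i => W i) i ⟨x, hx⟩ := by
    rw [LinearEquiv.symm_apply_eq]
    exact (DirectSum.coeLinearMap_lof W i ⟨x, hx⟩).symm
  simp [this]

theorem exists_isometry_of_blockwise [FiniteDimensional ℝ V] {B : V →ₗ[ℝ] V →ₗ[ℝ] ℝ}
    (hnondeg : ∀ x, (∀ y, B x y = 0) → x = 0) {S T : Module.End ℝ V} {ι : Type*}
    {Vb Wb : ι → Submodule ℝ V} (htop : ⨆ i, Vb i = ⊤) (hind : iSupIndep Vb)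
    (hVorth : ∀ i j, i ≠ j → ∀ x ∈ Vb i, ∀ y ∈ Vb j, B x y = 0)
    (hWorth : ∀ i j, i ≠ j → ∀ x ∈ Wb i, ∀ y ∈ Wb j, B x y = 0)
    (hSinv : ∀ i, ∀ x ∈ Vb i, S x ∈ Vb i)
    (hf : ∀ i, ∃ f : V →ₗ[ℝ] V, (Vb i).map f = Wb i ∧
      (∀ x ∈ Vb i, ∀ y ∈ Vb i, B (f x) (f y) = B x y) ∧ ∀ x ∈ Vb i, T (f x) = f (S x)) :
    ∃ R : V ≃ₗ[ℝ] V, (∀ x y, B (R x) (R y) = B x y) ∧ ∀ x, T x = R (S (R.symm x)) := by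
  classical
  choose f hfW hfB hfT using hf
  obtain ⟨R, hR⟩ := exists_linearMap_eq_on_components htop hind f
  have hspan : Submodule.span ℝ (⋃ i, (Vb i : Set V)) = ⊤ := by
    rw [← Submodule.iSup_eq_span, htop]
  have hRB : ∀ x y, B (R x) (R y) = B x y := fun x y => by
    refine bilin_map_eqOn_span (f := R) (s := ⋃ i, (Vb i : Set V)) ?_ x (hspan ▸ Submodule.mem_top)
      y (hspan ▸ Submodule.mem_top)
    simp only [Set.mem_iUnion, SetLike.mem_coe]
    rintro x ⟨i, hx⟩ y ⟨j, hy⟩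
    rw [hR i x hx, hR j y hy]
    by_cases hij : i = j
    · subst hij
      exact hfB i x hx y hy
    · rw [hVorth i j hij x hx y hy]
      exact hWorth i j hij _ (hfW i ▸ Submodule.mem_map_of_mem hx) _
        (hfW j ▸ Submodule.mem_map_of_mem hy)
  have hRT : ∀ x, T (R x) = R (S x) := fun x => by
    refine LinearMap.eqOn_span (f := T ∘ₗ R) (g := R ∘ₗ S) (s := ⋃ i, (Vb i : Set V)) ?_
      (hspan ▸ Submodule.mem_top : x ∈ _)
    intro x hx
    obtain ⟨i, hx⟩ := Set.mem_iUnion.1 hx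
    change T (R x) = R (S x)
    rw [hR i x hx, hR i _ (hSinv i x hx), hfT i x hx]
  have hinj : Function.Injective R := (injective_iff_map_eq_zero R).2 fun x hx =>
    hnondeg x fun y => by rw [← hRB, hx, map_zero, LinearMap.zero_apply]
  refine ⟨LinearEquiv.ofInjectiveEndo R hinj, hRB, fun x => ?_⟩
  obtain ⟨y, rfl⟩ := (LinearEquiv.ofInjectiveEndo R hinj).surjective x
  rw [LinearEquiv.symm_apply_apply]
  exact hRT y

/-- **Isometric equivalence of self-adjoint operators.**
Two self-adjoint operators `S`, `T` on a real scalar product space are conjugate by an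
isometry `R` iff they admit metric-Jordan decompositions with the same multiset of
block data: for each real datum `(lam, p, ε)` and each complex datum `(a, b, p)` with
`b > 0`, the number of blocks of that type for `S` equals that for `T`. -/
theorem isometrically_equivalent_iff_same_metric_jordan_form
    [FiniteDimensional ℝ V]
    (B : V →ₗ[ℝ] V →ₗ[ℝ] ℝ) (hsymm : ∀ x y, B x y = B y x)
    (hnondeg : ∀ x, (∀ y, B x y = 0) → x = 0)
    (S T : Module.End ℝ V)
    (hS : ∀ x y, B (S x) y = B x (S y)) (hT : ∀ x y, B (T x) y = B x (T y)) :
    (∃ R : V ≃ₗ[ℝ] V, (∀ x y, B (R x) (R y) = B x y) ∧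
        ∀ x, T x = R (S (R.symm x))) ↔
      ∃ (k : ℕ) (Vb Wb : Fin k → Submodule ℝ V),
        IsMetricJordanDecomposition B S Vb ∧
        IsMetricJordanDecomposition B T Wb ∧
        (∀ (lam : ℝ) (p : ℕ) (ε : ℝ),
          Nat.card {i : Fin k // IsRealBlock B S lam p ε (Vb i)} =
            Nat.card {j : Fin k // IsRealBlock B T lam p ε (Wb j)}) ∧
        (∀ (a b : ℝ) (p : ℕ), 0 < b →
          Nat.card {i : Fin k // IsComplexBlock B S a b p (Vb i)} =
            Nat.card {j : Fin k // IsComplexBlock B T a b p (Wb j)}) := by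
  constructor
  · rintro ⟨R, hRB, hRT⟩
    have hRS : ∀ x, T (R x) = R (S x) := fun x => by rw [hRT, R.symm_apply_apply]
    obtain ⟨k, W, hW⟩ := exists_metricJordanDecomposition _ V rfl B hsymm hnondeg S hS
    have hdata : ∀ d i, HasBlockData B S d (W i) ↔
        HasBlockData B T d ((W i).map R.toLinearMap) := fun d i =>
      ⟨fun h => h.map hsymm R.toLinearMap (fun x _ y _ => hRB x y) (fun x _ => hRS x), fun h => by
        have h' := HasBlockData.map (T := S) hsymm h R.symm.toLinearMap
          (fun x _ y _ => by
            rw [← hRB]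
            simp)
          (fun x _ => by
            simp [hRT x])
        rwa [← Submodule.map_comp, LinearEquiv.comp_coe, LinearEquiv.self_trans_symm,
          LinearEquiv.refl_toLinearMap, Submodule.map_id] at h'⟩
    obtain ⟨htop, -, horth, hinv, hblock⟩ := id hW
    have htop' : ⨆ i, (W i).map R.toLinearMap = ⊤ := by
      rw [← Submodule.map_iSup, htop, Submodule.map_top, LinearEquiv.range]
    have horth' : ∀ i j, i ≠ j → ∀ x ∈ (W i).map R.toLinearMap,
        ∀ y ∈ (W j).map R.toLinearMap, B x y = 0 := by
      rintro i j hij _ ⟨x, hx, rfl⟩ _ ⟨y, hy, rfl⟩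
      exact (hRB x y).trans (horth i j hij x hx y hy)
    refine ⟨k, W, fun i => (W i).map R.toLinearMap, hW, ⟨htop',
      iSupIndep_of_orthogonal hsymm hnondeg htop' horth', horth', ?_, ?_⟩, ?_, ?_⟩
    · rintro i _ ⟨x, hx, rfl⟩
      exact ⟨S x, hinv i x hx, (hRS x).symm⟩
    · intro i
      rcases hblock i with ⟨lam, p, ε, h⟩ | ⟨a, b, p, h⟩
      · exact Or.inl ⟨lam, p, ε, (hdata (Sum.inl (lam, p, ε)) i).1 h⟩
      · exact Or.inr ⟨a, b, p, (hdata (Sum.inr (a, b, p)) i).1 h⟩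
    · exact fun lam p ε => Nat.card_congr
        (Equiv.subtypeEquivRight fun i => hdata (Sum.inl (lam, p, ε)) i)
    · exact fun a b p _ => Nat.card_congr
        (Equiv.subtypeEquivRight fun i => hdata (Sum.inr (a, b, p)) i)
  · rintro ⟨k, Vb, Wb, ⟨hVtop, hVind, hVorth, hVinv, hVblock⟩,
      ⟨-, -, hWorth, -, hWblock⟩, hreal, hcomplex⟩
    obtain ⟨σ, hσ⟩ := exists_equiv_of_card_mem_eq
      (fun i => {d | HasBlockData B S d (Vb i)}) (fun j => {d | HasBlockData B T d (Wb j)})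
      (fun i => by
        rcases hVblock i with ⟨lam, p, ε, h⟩ | ⟨a, b, p, h⟩
        exacts [⟨Sum.inl (lam, p, ε), h⟩, ⟨Sum.inr (a, b, p), h⟩])
      (fun i => by
        rcases hWblock i with ⟨lam, p, ε, h⟩ | ⟨a, b, p, h⟩
        exacts [⟨Sum.inl (lam, p, ε), h⟩, ⟨Sum.inr (a, b, p), h⟩])
      (fun d i j hi hj => Set.ext fun d' => ⟨HasBlockData.imp hsymm hi hj,
        HasBlockData.imp hsymm hj hi⟩)
      (fun d i j hi hj => Set.ext fun d' => ⟨HasBlockData.imp hsymm hi hj,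
        HasBlockData.imp hsymm hj hi⟩)
      (fun d i j hi hj => Set.ext fun d' => ⟨HasBlockData.imp hsymm hi hj,
        HasBlockData.imp hsymm hj hi⟩)
      (fun d => by
        rcases d with ⟨lam, p, ε⟩ | ⟨a, b, p⟩
        · exact hreal lam p ε
        · by_cases hb : 0 < b
          · exact hcomplex a b p hb
          · have h1 : IsEmpty {i // Sum.inr (a, b, p) ∈ {d | HasBlockData B S d (Vb i)}} :=
              Subtype.isEmpty_of_false fun i h => hb h.2.1
            have h2 : IsEmpty {i // Sum.inr (a, b, p) ∈ {d | HasBlockData B T d (Wb i)}} :=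
              Subtype.isEmpty_of_false fun i h => hb h.2.1
            rw [Nat.card_of_isEmpty, Nat.card_of_isEmpty])
    refine exists_isometry_of_blockwise hnondeg (Wb := Wb ∘ σ) hVtop hVind hVorth
      (fun i j hij => hWorth _ _ (σ.injective.ne hij)) hVinv fun i => ?_
    obtain ⟨d, hd⟩ : ∃ d, HasBlockData B S d (Vb i) := by
      rcases hVblock i with ⟨lam, p, ε, h⟩ | ⟨a, b, p, h⟩
      exacts [⟨Sum.inl (lam, p, ε), h⟩, ⟨Sum.inr (a, b, p), h⟩]
    exact hd.exists_map_eq hsymm ((Set.ext_iff.1 (hσ i) d).2 hd)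

end MetricJordan
end
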